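/- arXiv:2011.10067 — 3 statements merged into one kernel-verified Lean document; each statement's English description precedes it below -/
import Mathlib

section
/- For every ε > 0 there exist K > 0 and N such that for every odd n ≥ N: μ_n({A : Var_A − 12·CV_A² > K·n}) < ε. -/
open MeasureTheory ProbabilityTheory Set
open scoped ENNReal NNReal

noncomputable def extendDie (n : ℕ) (s : ℝ) (a : Fin (n - 1) → ℝ) : Fin n → ℝ :=
  fun i => if h : (i : ℕ) < n - 1 then a ⟨i, h⟩ else s - ∑ j, a j

noncomputable def diceMeasure (n : ℕ) (lo hi s : ℝ) : Measure (Fin n → ℝ) :=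
  Measure.map (extendDie n s)
    (ProbabilityTheory.cond volume
      {a : Fin (n - 1) → ℝ | (∀ i, a i ∈ Set.Icc lo hi) ∧ (s - ∑ i, a i) ∈ Set.Icc lo hi})

/-- `g_A(x) = |{i : a_i ≤ x}| - n·x` for a die with faces in `[0,1]`. -/
noncomputable def gDie (n : ℕ) (A : Fin n → ℝ) (x : ℝ) : ℝ :=
  ((Finset.univ.filter fun i => A i ≤ x).card : ℝ) - n * x

/-- Expectation with respect to `V` uniform on `[0,1]`. -/
noncomputable def mean01 (f : ℝ → ℝ) : ℝ := ∫ x in Set.Icc (0 : ℝ) 1, f x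

/-- `Var_A = Var(g_A(V))`. -/
noncomputable def varDie (n : ℕ) (A : Fin n → ℝ) : ℝ :=
  mean01 (fun x => gDie n A x ^ 2) - mean01 (gDie n A) ^ 2

/-- `CV_A = Cov(g_A(V), V)`. -/
noncomputable def cvDie (n : ℕ) (A : Fin n → ℝ) : ℝ :=
  mean01 (fun x => gDie n A x * x) - mean01 (gDie n A) * mean01 (fun x => x)


namespace DiceAux

/-- Uniform measure on the unit interval. -/
noncomputable def lam : Measure ℝ := volume.restrict (Set.Icc (0 : ℝ) 1)

instance lam_prob : IsProbabilityMeasure lam := ⟨by simp [lam]⟩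

/-- Product of uniform measures. -/
noncomputable def P (k : ℕ) : Measure (Fin k → ℝ) := Measure.pi (fun _ => lam)

instance P_prob (k : ℕ) : IsProbabilityMeasure (P k) := by unfold P; infer_instance

lemma lintegral_half (f : ℝ → ℝ≥0∞) :
    ∫⁻ u, f u ∂lam = 2⁻¹ * (∫⁻ u, f (u / 2) ∂lam + ∫⁻ u, f ((u + 1) / 2) ∂lam) := by
  have h1 : ∫⁻ u in Set.Icc (0 : ℝ) (1/2), f u = 2⁻¹ * ∫⁻ u, f (u / 2) ∂lam := by
    have := lintegral_image_eq_lintegral_abs_deriv_mul (s := Set.Icc (0 : ℝ) 1)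
      (f := fun u : ℝ => u / 2) (f' := fun _ => 1 / 2) measurableSet_Icc
      (fun x _ => ((hasDerivAt_id x).div_const 2).hasDerivWithinAt)
      (fun x _ y _ h => by simpa using h) f
    have himg : (fun u : ℝ => u / 2) '' Set.Icc (0 : ℝ) 1 = Set.Icc 0 (1/2) := by
      ext y
      simp only [Set.mem_image, Set.mem_Icc]
      constructor
      · rintro ⟨x, hx, rfl⟩; constructor <;> linarith [hx.1, hx.2]
      · intro h; exact ⟨2 * y, ⟨by linarith [h.1], by linarith [h.2]⟩, by ring⟩
    rw [himg] at this
    rw [this, lintegral_const_mul']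
    · congr 1
      rw [abs_of_pos (by norm_num), ENNReal.ofReal_div_of_pos (by norm_num)]
      simp
    · exact ENNReal.ofReal_ne_top
  have h2 : ∫⁻ u in Set.Icc (1/2 : ℝ) 1, f u = 2⁻¹ * ∫⁻ u, f ((u + 1) / 2) ∂lam := by
    have := lintegral_image_eq_lintegral_abs_deriv_mul (s := Set.Icc (0 : ℝ) 1)
      (f := fun u : ℝ => (u + 1) / 2) (f' := fun _ => 1 / 2) measurableSet_Icc
      (fun x _ => (((hasDerivAt_id x).add_const 1).div_const 2).hasDerivWithinAt)
      (fun x _ y _ h => by simpa using h) f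
    have himg : (fun u : ℝ => (u + 1) / 2) '' Set.Icc (0 : ℝ) 1 = Set.Icc (1/2) 1 := by
      ext y
      simp only [Set.mem_image, Set.mem_Icc]
      constructor
      · rintro ⟨x, hx, rfl⟩; constructor <;> linarith [hx.1, hx.2]
      · intro h; exact ⟨2 * y - 1, ⟨by linarith [h.1], by linarith [h.2]⟩, by ring⟩
    rw [himg] at this
    rw [this, lintegral_const_mul']
    · congr 1
      rw [abs_of_pos (by norm_num), ENNReal.ofReal_div_of_pos (by norm_num)]
      simp
    · exact ENNReal.ofReal_ne_top
  rw [mul_add, ← h1, ← h2, lam, ← setLIntegral_congr (Ioc_ae_eq_Icc (a := (1/2 : ℝ)) (b := 1)),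
    ← lintegral_union measurableSet_Ioc]
  · rw [Set.Icc_union_Ioc_eq_Icc (by norm_num) (by norm_num)]
  · rw [Set.disjoint_left]
    intro x hx hy
    exact absurd hx.2 (not_le.2 hy.1)

lemma lintegral_P_succ (k : ℕ) (f : ℝ → ℝ≥0∞) (hf : Measurable f) :
    ∫⁻ b, f (∑ i, b i) ∂(P (k + 1)) = ∫⁻ u, ∫⁻ b, f (u + ∑ i, b i) ∂(P k) ∂lam := by
  have := (measurePreserving_piFinSuccAbove (fun _ : Fin (k + 1) => lam) 0)
  have h2 := this.lintegral_comp (f := fun p : ℝ × (Fin k → ℝ) => f (p.1 + ∑ i, p.2 i))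
    (by fun_prop)
  unfold P
  rw [← lintegral_prod (f := fun p : ℝ × (Fin k → ℝ) => f (p.1 + ∑ i, p.2 i)) (by fun_prop)]
  rw [← h2]
  congr 1
  ext b
  rw [Fin.sum_univ_succ]
  rfl

lemma lintegral_P_mix (k : ℕ) : ∀ (f : ℝ → ℝ≥0∞), Measurable f →
    ∫⁻ b, f (∑ i, b i) ∂(P k) =
      2⁻¹ ^ k * ∑ T ∈ (Finset.range k).powerset, ∫⁻ b, f (((T.card : ℝ) + ∑ i, b i) / 2) ∂(P k) := by
  induction k with
  | zero => intro f hf; simp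
  | succ k ih =>
    intro f hf
    rw [lintegral_P_succ k f hf]
    have e1 : ∀ u, ∫⁻ b, f (u + ∑ i, b i) ∂(P k) = 2⁻¹ ^ k * ∑ T ∈ (Finset.range k).powerset,
        ∫⁻ b, f (u + ((T.card : ℝ) + ∑ i, b i) / 2) ∂(P k) := fun u =>
      ih (fun s => f (u + s)) (by fun_prop)
    simp_rw [e1]
    have hm : ∀ T : Finset ℕ, Measurable (fun u : ℝ =>
        ∫⁻ b, f (u + ((T.card : ℝ) + ∑ i, b i) / 2) ∂(P k)) := fun T =>
      Measurable.lintegral_prod_right' (f := fun p : ℝ × (Fin k → ℝ) =>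
        f (p.1 + ((T.card : ℝ) + ∑ i, p.2 i) / 2)) (by fun_prop)
    rw [lintegral_const_mul _ (Finset.measurable_sum _ fun T _ => hm T),
      lintegral_finsetSum _ (fun T _ => hm T), pow_succ, mul_assoc]
    congr 1
    rw [Finset.range_add_one, Finset.sum_powerset_insert (by simp), ← Finset.sum_add_distrib,
      Finset.mul_sum]
    refine Finset.sum_congr rfl fun T hT => ?_
    rw [lintegral_half]
    congr 2
    · rw [lintegral_P_succ k (fun s => f (((T.card : ℝ) + s) / 2)) (by fun_prop)]
      congr 1; ext u; congr 1; ext b; congr 1; ring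
    · have hk : k ∉ T := fun h => by
        have := Finset.mem_powerset.1 hT h
        simp at this
      rw [Finset.card_insert_of_notMem hk,
        lintegral_P_succ k (fun s => f ((((T.card + 1 : ℕ) : ℝ) + s) / 2)) (by fun_prop)]
      congr 1; ext u; congr 1; ext b; congr 1; push_cast; ring

lemma central_sq (m : ℕ) : (Nat.centralBinom m) ^ 2 * (2 * m + 1) ≤ 16 ^ m := by
  induction m with
  | zero => simp
  | succ m ih =>
    have h := Nat.succ_mul_centralBinom_succ m
    have h2 : (m + 1) ^ 2 * ((Nat.centralBinom (m + 1)) ^ 2 * (2 * (m + 1) + 1))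
        ≤ (m + 1) ^ 2 * 16 ^ (m + 1) := by
      calc (m + 1) ^ 2 * ((Nat.centralBinom (m + 1)) ^ 2 * (2 * (m + 1) + 1))
          = ((m + 1) * Nat.centralBinom (m + 1)) ^ 2 * (2 * m + 3) := by ring
        _ = (Nat.centralBinom m ^ 2 * (2 * m + 1)) * (4 * (2 * m + 1) * (2 * m + 3)) := by
            rw [h]; ring
        _ ≤ 16 ^ m * (16 * (m + 1) ^ 2) := by
            apply Nat.mul_le_mul ih; nlinarith
        _ = _ := by ring
    exact Nat.le_of_mul_le_mul_left h2 (by positivity)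

lemma choose_bound (k j : ℕ) : (Nat.choose k j) ^ 2 * k ≤ 4 ^ k := by
  rcases Nat.even_or_odd' k with ⟨m, rfl | rfl⟩
  · calc (Nat.choose (2 * m) j) ^ 2 * (2 * m) ≤ (Nat.centralBinom m) ^ 2 * (2 * m + 1) := by
          gcongr
          · exact Nat.choose_le_centralBinom j m
          · omega
      _ ≤ 16 ^ m := central_sq m
      _ = 4 ^ (2 * m) := by rw [pow_mul]; norm_num
  · have : Nat.choose (2 * m + 1) j ≤ 2 * Nat.centralBinom m := by
      rcases j with _ | j
      · have := Nat.centralBinom_pos m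
        simp; omega
      · rw [Nat.choose_succ_succ]
        have := Nat.choose_le_centralBinom j m
        have := Nat.choose_le_centralBinom (j+1) m
        simp only [Nat.succ_eq_add_one]
        omega
    calc (Nat.choose (2 * m + 1) j) ^ 2 * (2 * m + 1)
        ≤ (2 * Nat.centralBinom m) ^ 2 * (2 * m + 1) := by gcongr
      _ = 4 * ((Nat.centralBinom m) ^ 2 * (2 * m + 1)) := by ring
      _ ≤ 4 * 16 ^ m := by gcongr; exact central_sq m
      _ = 4 ^ (2 * m + 1) := by rw [pow_succ, pow_mul]; norm_num; ring

lemma choose_bound' (k j : ℕ) (hk : 0 < k) :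
    (2⁻¹ : ℝ≥0∞) ^ k * (Nat.choose k j : ℝ≥0∞) ≤ ENNReal.ofReal (1 / √k) := by
  have hk' : (0 : ℝ) < k := by exact_mod_cast hk
  have h : ((Nat.choose k j : ℝ)) ≤ 2 ^ k / √k := by
    rw [le_div_iff₀ (by positivity)]
    refine (sq_le_sq₀ (by positivity) (by positivity)).1 ?_
    rw [mul_pow, Real.sq_sqrt hk'.le, ← pow_mul, mul_comm k 2, pow_mul]
    norm_num
    exact_mod_cast choose_bound k j
  have : (2⁻¹ : ℝ≥0∞) ^ k * (Nat.choose k j : ℝ≥0∞)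
      = ENNReal.ofReal ((2⁻¹) ^ k * (Nat.choose k j : ℝ)) := by
    rw [ENNReal.ofReal_mul (by positivity), ENNReal.ofReal_natCast,
      ENNReal.ofReal_pow (by positivity), ENNReal.ofReal_inv_of_pos (by norm_num)]
    simp
  rw [this]
  apply ENNReal.ofReal_le_ofReal
  calc (2⁻¹ : ℝ) ^ k * (Nat.choose k j : ℝ) ≤ 2⁻¹ ^ k * (2 ^ k / √k) := by gcongr
    _ = 1 / √k := by
      rw [← mul_div_assoc, ← mul_pow]; norm_num

/-- Anticoncentration of the Irwin-Hall distribution. -/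
lemma anticonc (k : ℕ) (hk : 0 < k) (y : ℝ) :
    P k {b | ∑ i, b i ∈ Set.Icc y (y + 1)} ≤ ENNReal.ofReal (3 / √k) := by
  set f : ℝ → ℝ≥0∞ := (Set.Icc y (y + 1)).indicator 1 with hfdef
  have hf : Measurable f := measurable_one.indicator measurableSet_Icc
  have hm : Measurable (fun b : Fin k → ℝ => ∑ i, b i) := by fun_prop
  have h0 : P k {b | ∑ i, b i ∈ Set.Icc y (y + 1)} = ∫⁻ b, f (∑ i, b i) ∂(P k) := by
    have hS : MeasurableSet {b : Fin k → ℝ | ∑ i, b i ∈ Set.Icc y (y + 1)} :=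
      hm measurableSet_Icc
    rw [← lintegral_indicator_one hS]
    rfl
  rw [h0, lintegral_P_mix k f hf, Finset.sum_powerset_apply_card
    (fun j => ∫⁻ b, f (((j : ℝ) + ∑ i, b i) / 2) ∂(P k)), Finset.card_range, Finset.mul_sum]
  calc ∑ j ∈ Finset.range (k + 1), 2⁻¹ ^ k * (k.choose j • ∫⁻ b, f (((j : ℝ) + ∑ i, b i) / 2) ∂(P k))
      ≤ ∑ j ∈ Finset.range (k + 1),
        ENNReal.ofReal (1 / √k) * ∫⁻ b, f (((j : ℝ) + ∑ i, b i) / 2) ∂(P k) := by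
        refine Finset.sum_le_sum fun j _ => ?_
        rw [nsmul_eq_mul, ← mul_assoc]
        gcongr
        exact choose_bound' k j hk
    _ = ENNReal.ofReal (1 / √k) *
        ∫⁻ b, ∑ j ∈ Finset.range (k + 1), f (((j : ℝ) + ∑ i, b i) / 2) ∂(P k) := by
        rw [← Finset.mul_sum, lintegral_finsetSum]
        intro j _
        fun_prop
    _ ≤ ENNReal.ofReal (1 / √k) * ∫⁻ b, 3 ∂(P k) := by
        gcongr with b
        set s := ∑ i, b i
        have : ∑ j ∈ Finset.range (k + 1), f (((j : ℝ) + s) / 2) ≤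
          ∑ j ∈ Finset.range (k + 1), if (j : ℤ) ∈ Finset.Icc ⌈2 * y - s⌉ (⌈2 * y - s⌉ + 2)
            then 1 else 0 := by
          refine Finset.sum_le_sum fun j _ => ?_
          by_cases hj : ((j : ℝ) + s) / 2 ∈ Set.Icc y (y + 1)
          · rw [if_pos]
            · simp [f, hj]
            · rw [Finset.mem_Icc]
              constructor
              · rw [Int.ceil_le]; push_cast; linarith [hj.1]
              · have : ((j : ℤ) : ℝ) ≤ (⌈2 * y - s⌉ + 2 : ℤ) := by
                  push_cast
                  linarith [hj.2, Int.le_ceil (2 * y - s)]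
                exact_mod_cast this
          · simp [f, hj]
        refine this.trans ?_
        rw [Finset.sum_boole]
        have hc : (Finset.filter (fun j : ℕ => (j : ℤ) ∈ Finset.Icc ⌈2 * y - s⌉ (⌈2 * y - s⌉ + 2))
            (Finset.range (k + 1))).card ≤ 3 := by
          calc _ ≤ (Finset.Icc ⌈2 * y - s⌉ (⌈2 * y - s⌉ + 2)).card := by
                apply Finset.card_le_card_of_injOn (fun j : ℕ => (j : ℤ))
                · intro j hj; simpa using (Finset.mem_filter.1 hj).2
                · intro a _ b _ h; simpa using h
            _ = 3 := by simp; omega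
        exact_mod_cast hc
    _ = ENNReal.ofReal (3 / √k) := by
        rw [lintegral_const, measure_univ, mul_one, show (3 : ℝ) / √k = 1 / √k * 3 by ring,
          ENNReal.ofReal_mul (by positivity)]
        simp

lemma second_moment (k : ℕ) (X : ℝ → ℝ) (hX : Measurable X)
    (hb : ∀ u ∈ Set.Icc (0 : ℝ) 1, |X u| ≤ 1) (h0 : ∫ u, X u ∂lam = 0) :
    ∫⁻ b, ENNReal.ofReal ((∑ i, X (b i)) ^ 2) ∂(P k) ≤ k := by
  have hae : ∀ᵐ u ∂lam, |X u| ≤ 1 := by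
    unfold lam
    exact (ae_restrict_iff' measurableSet_Icc).2 (Filter.Eventually.of_forall hb)
  have hL : MemLp X 2 lam := MemLp.of_bound hX.aestronglyMeasurable 1 hae
  have hmp : ∀ i : Fin k, MeasurePreserving (fun b : Fin k → ℝ => b i) (P k) lam := fun i =>
    measurePreserving_eval (fun _ => lam) i
  have hLi : ∀ i : Fin k, MemLp (fun b : Fin k → ℝ => X (b i)) 2 (P k) := fun i =>
    hL.comp_measurePreserving (hmp i)
  have hLs : MemLp (fun b : Fin k → ℝ => ∑ i, X (b i)) 2 (P k) :=
    memLp_finsetSum _ fun i _ => hLi i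
  have hv : Var[X; lam] ≤ 1 := by
    rw [variance_of_integral_eq_zero hX.aemeasurable h0]
    calc ∫ u, X u ^ 2 ∂lam ≤ ∫ u, (1 : ℝ) ∂lam := by
          apply integral_mono_ae hL.integrable_sq (integrable_const _)
          filter_upwards [hae] with u hu
          exact (sq_le_one_iff_abs_le_one _).2 hu
      _ = 1 := by simp
  have hmean : ∫ b, ∑ i, X (b i) ∂(P k) = 0 := by
    rw [integral_finsetSum _ fun i _ => (hLi i).integrable (by norm_num)]
    refine Finset.sum_eq_zero fun i _ => ?_
    rw [← h0, ← (hmp i).map_eq, integral_map (hmp i).measurable.aemeasurable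
      hX.aestronglyMeasurable]
  have hvs := variance_sum_pi (μ := fun _ : Fin k => lam) (X := fun _ => X) (fun _ => hL)
  have hfun : (∑ i : Fin k, fun ω : Fin k → ℝ => X (ω i)) = fun b => ∑ i, X (b i) := by
    ext b; simp
  rw [hfun] at hvs
  change Var[_; P k] = _ at hvs
  rw [variance_of_integral_eq_zero hLs.aestronglyMeasurable.aemeasurable hmean] at hvs
  have hle : ∫ b, (∑ i, X (b i)) ^ 2 ∂(P k) ≤ k := by
    rw [hvs]
    calc _ ≤ ∑ i : Fin k, (1 : ℝ) := Finset.sum_le_sum fun i _ => hv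
      _ = k := by simp
  rw [← ofReal_integral_eq_lintegral_ofReal hLs.integrable_sq
    (Filter.Eventually.of_forall fun b => sq_nonneg _)]
  rw [← ENNReal.ofReal_natCast]
  exact ENNReal.ofReal_le_ofReal hle

lemma integral_lam (f : ℝ → ℝ) : ∫ u, f u ∂lam = ∫ u in (0 : ℝ)..1, f u := by
  rw [lam, intervalIntegral.integral_of_le zero_le_one, integral_Icc_eq_integral_Ioc]

lemma reflect (k : ℕ) : MeasurePreserving (fun (b : Fin k → ℝ) i => 1 - b i) (P k) (P k) := by
  refine measurePreserving_pi (fun _ => lam) (fun _ => lam) (f := fun _ u => 1 - u) fun _ => ?_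
  have h := (Measure.measurePreserving_sub_left (volume : Measure ℝ) 1).restrict_preimage
    (s := Set.Icc (0 : ℝ) 1) measurableSet_Icc
  have : (fun x : ℝ => 1 - x) ⁻¹' Set.Icc (0 : ℝ) 1 = Set.Icc 0 1 := by
    ext x; simp only [Set.mem_preimage, Set.mem_Icc]; constructor <;> rintro ⟨h1, h2⟩ <;>
      constructor <;> linarith
  rw [this] at h
  exact h

lemma conc (k : ℕ) (hk : 0 < k) :
    3 / 4 ≤ (P k).real {b | |∑ i, b i - k / 2| < 2 * √k} := by
  have hk' : (0 : ℝ) < k := by exact_mod_cast hk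
  have hsm := second_moment k (fun u => u - 1 / 2) (by fun_prop)
    (fun u hu => abs_le.2 ⟨by linarith [hu.1], by linarith [hu.2]⟩)
    (by rw [integral_lam]; simp)
  set B : Set (Fin k → ℝ) := {b | |∑ i, b i - k / 2| < 2 * √k} with hB
  have hBm : MeasurableSet B := by
    apply measurableSet_lt <;> fun_prop
  have hmk := mul_meas_ge_le_lintegral (μ := P k)
    (f := fun b : Fin k → ℝ => ENNReal.ofReal ((∑ i, (b i - 1 / 2)) ^ 2)) (by fun_prop)
    (ENNReal.ofReal (4 * k))
  have hsub : Bᶜ ⊆ {b : Fin k → ℝ | ENNReal.ofReal (4 * k) ≤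
      ENNReal.ofReal ((∑ i, (b i - 1 / 2)) ^ 2)} := by
    intro b hb
    simp only [B, Set.mem_compl_iff, Set.mem_ofPred_eq, not_lt] at hb ⊢
    apply ENNReal.ofReal_le_ofReal
    have e : ∑ i, (b i - 1 / 2) = ∑ i, b i - k / 2 := by
      rw [Finset.sum_sub_distrib]; simp; ring
    rw [e, ← sq_abs (∑ i, b i - k / 2)]
    calc (4 * k : ℝ) = (2 * √k) ^ 2 := by rw [mul_pow, Real.sq_sqrt hk'.le]; norm_num
      _ ≤ _ := by gcongr
  have h1 : ENNReal.ofReal (4 * k) * P k Bᶜ ≤ k :=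
    (mul_le_mul_right (measure_mono hsub) _).trans (hmk.trans hsm)
  have h2 : 4 * k * (P k).real Bᶜ ≤ k := by
    have := ENNReal.toReal_mono (by simp) h1
    rw [ENNReal.toReal_mul, ENNReal.toReal_ofReal (by positivity)] at this
    simpa [Measure.real] using this
  rw [probReal_compl_eq_one_sub hBm] at h2
  by_contra hcon
  push Not at hcon
  nlinarith

lemma lower (k : ℕ) (hk : 0 < k) :
    1 / (20 * √k) ≤ ((P k).prod (P k)).real
      {p | (k : ℝ) + 1 / 2 - (∑ i, p.1 i + ∑ i, p.2 i) ∈ Set.Icc (0 : ℝ) 1} := by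
  have hk' : (0 : ℝ) < k := by exact_mod_cast hk
  have hs1 : 1 ≤ √(k : ℝ) := Real.one_le_sqrt.2 (by exact_mod_cast hk)
  set T : Set ((Fin k → ℝ) × (Fin k → ℝ)) :=
    {p | (k : ℝ) + 1 / 2 - (∑ i, p.1 i + ∑ i, p.2 i) ∈ Set.Icc (0 : ℝ) 1} with hT
  have hTm : MeasurableSet T := by
    have : Measurable (fun p : (Fin k → ℝ) × (Fin k → ℝ) =>
      (k : ℝ) + 1 / 2 - (∑ i, p.1 i + ∑ i, p.2 i)) := by fun_prop
    exact this measurableSet_Icc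
  have hR := (MeasurePreserving.id (P k)).prod (reflect k)
  have hTR : ((P k).prod (P k)).real T = ((P k).prod (P k)).real
      (Prod.map id (fun (b : Fin k → ℝ) i => 1 - b i) ⁻¹' T) := by
    rw [Measure.real, Measure.real, hR.measure_preimage hTm.nullMeasurableSet]
  let A : ℤ → Set (Fin k → ℝ) := fun j => {b | ⌊2 * ∑ i, b i⌋ = j}
  have hAm : ∀ j, MeasurableSet (A j) := fun j => by
    have : Measurable (fun b : Fin k → ℝ => ⌊2 * ∑ i, b i⌋) := by fun_prop
    exact this (measurableSet_singleton j)
  set J : Finset ℤ := Finset.Icc ⌊(k : ℝ) - 4 * √k⌋ ⌊(k : ℝ) + 4 * √k⌋ with hJ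
  have hJc : (J.card : ℝ) ≤ 10 * √k := by
    have hle : ⌊(k : ℝ) - 4 * √k⌋ ≤ ⌊(k : ℝ) + 4 * √k⌋ := Int.floor_le_floor (by linarith)
    have : (J.card : ℤ) = ⌊(k : ℝ) + 4 * √k⌋ + 1 - ⌊(k : ℝ) - 4 * √k⌋ := by
      rw [hJ, Int.card_Icc, Int.toNat_of_nonneg (by omega)]
    have h2 : (J.card : ℝ) = ⌊(k : ℝ) + 4 * √k⌋ + 1 - ⌊(k : ℝ) - 4 * √k⌋ := by exact_mod_cast this
    rw [h2]
    linarith [Int.floor_le ((k : ℝ) + 4 * √k), Int.lt_floor_add_one ((k : ℝ) - 4 * √k)]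
  have h34 : 3 / 4 ≤ ∑ j ∈ J, (P k).real (A j) := by
    refine (conc k hk).trans ?_
    refine le_trans (measureReal_mono (h₂ := measure_ne_top _ _) ?_) (measureReal_biUnion_finset_le J A)
    intro b hb
    have hb' := abs_lt.1 (show |∑ i, b i - k / 2| < 2 * √k from hb)
    simp only [Set.mem_iUnion]
    refine ⟨⌊2 * ∑ i, b i⌋, ?_, rfl⟩
    rw [hJ, Finset.mem_Icc]
    exact ⟨Int.floor_le_floor (by linarith), Int.floor_le_floor (by linarith)⟩
  have hsum : ∑ j ∈ J, (P k).real (A j) ^ 2 ≤ ((P k).prod (P k)).real T := by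
    rw [hTR]
    have e : ∀ j, (P k).real (A j) ^ 2 = ((P k).prod (P k)).real (A j ×ˢ A j) := fun j => by
      rw [measureReal_prod_prod, sq]
    simp_rw [e]
    rw [← measureReal_biUnion_finset]
    · apply measureReal_mono _ (by finiteness)
      intro p hp
      simp only [Set.mem_iUnion] at hp
      obtain ⟨j, -, hp1, hp2⟩ := hp
      have e1 : ⌊2 * ∑ i, p.1 i⌋ = j := hp1
      have e2 : ⌊2 * ∑ i, p.2 i⌋ = j := hp2
      rw [Int.floor_eq_iff] at e1 e2
      simp only [T, Set.mem_preimage, Set.mem_ofPred_eq, Prod.map_fst, Prod.map_snd, id,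
        Finset.sum_sub_distrib, Set.mem_Icc]
      simp
      constructor <;> linarith [e1.1, e1.2, e2.1, e2.2]
    · intro i _ j _ hij
      rw [Function.onFun, Set.disjoint_left]
      intro p hp hq
      exact hij ((show ⌊2 * ∑ i, p.1 i⌋ = i from hp.1).symm.trans hq.1)
    · intro j _
      exact (hAm j).prod (hAm j)
  have hcs := sq_sum_le_card_mul_sum_sq (s := J) (f := fun j => (P k).real (A j))
  have h9 : (9 / 16 : ℝ) ≤ (∑ j ∈ J, (P k).real (A j)) ^ 2 := by nlinarith
  have hnn : 0 ≤ ∑ j ∈ J, (P k).real (A j) ^ 2 := Finset.sum_nonneg fun j _ => sq_nonneg _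
  have h10 : (9 / 16 : ℝ) ≤ 10 * √k * ((P k).prod (P k)).real T :=
    h9.trans (hcs.trans (mul_le_mul hJc hsum hnn (by positivity)))
  rw [div_le_iff₀ (by positivity)]
  linarith

/-- Gluing two half-vectors. -/
noncomputable def glue (k : ℕ) (p : (Fin k → ℝ) × (Fin k → ℝ)) : Fin (2 * k) → ℝ :=
  fun i => Sum.elim p.1 p.2 ((finSumFinEquiv.trans (finCongr (two_mul k).symm)).symm i)

lemma glue_sum (k : ℕ) (p : (Fin k → ℝ) × (Fin k → ℝ)) (G : ℝ → ℝ) :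
    ∑ i, G (glue k p i) = ∑ i, G (p.1 i) + ∑ i, G (p.2 i) := by
  rw [← Equiv.sum_comp (finSumFinEquiv.trans (finCongr (two_mul k).symm)), Fintype.sum_sum_type]
  simp only [glue, Equiv.symm_apply_apply, Sum.elim_inl, Sum.elim_inr]

lemma glue_mp (k : ℕ) : MeasurePreserving (glue k) ((P k).prod (P k)) (P (2 * k)) := by
  have h1 := measurePreserving_piCongrLeft (fun _ : Fin (2 * k) => lam)
    (finSumFinEquiv.trans (finCongr (two_mul k).symm))
  have h2 := measurePreserving_sumPiEquivProdPi_symm (fun _ : Fin k ⊕ Fin k => lam)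
  have h3 := h1.comp h2
  suffices hg : glue k = (MeasurableEquiv.piCongrLeft (fun _ => ℝ)
      (finSumFinEquiv.trans (finCongr (two_mul k).symm))) ∘
      (MeasurableEquiv.sumPiEquivProdPi fun _ : Fin k ⊕ Fin k => ℝ).symm by
    rw [hg]; exact h3
  ext p i
  obtain ⟨j, rfl⟩ := (finSumFinEquiv.trans (finCongr (two_mul k).symm)).surjective i
  rw [Function.comp_apply, MeasurableEquiv.piCongrLeft_apply_apply]
  rcases j with j | j <;> simp only [glue, Equiv.symm_apply_apply] <;> rfl

/-- Window event for two halves. -/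
def W (k : ℕ) : Set ((Fin k → ℝ) × (Fin k → ℝ)) :=
  {p | (k : ℝ) + 1 / 2 - (∑ i, p.1 i + ∑ i, p.2 i) ∈ Set.Icc (0 : ℝ) 1}

lemma W_meas (k : ℕ) : MeasurableSet (W k) := by
  have : Measurable (fun p : (Fin k → ℝ) × (Fin k → ℝ) =>
    (k : ℝ) + 1 / 2 - (∑ i, p.1 i + ∑ i, p.2 i)) := by fun_prop
  exact this measurableSet_Icc

lemma cross (k : ℕ) (hk : 0 < k) (H : (Fin k → ℝ) → ℝ≥0∞) (hH : Measurable H) :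
    ∫⁻ p in W k, H p.1 ∂((P k).prod (P k)) ≤ ENNReal.ofReal (3 / √k) * ∫⁻ b, H b ∂(P k) := by
  rw [← lintegral_indicator (W_meas k), lintegral_prod _
    (Measurable.indicator (by fun_prop) (W_meas k)).aemeasurable, ← lintegral_const_mul _ hH]
  refine lintegral_mono fun b => ?_
  have : ∀ c, (W k).indicator (fun p : (Fin k → ℝ) × (Fin k → ℝ) => H p.1) (b, c) =
      H b * ({c : Fin k → ℝ | ∑ i, c i ∈ Set.Icc ((k : ℝ) - 1 / 2 - ∑ i, b i)
        ((k : ℝ) - 1 / 2 - ∑ i, b i + 1)}).indicator 1 c := by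
    intro c
    by_cases hc : (b, c) ∈ W k
    · rw [Set.indicator_of_mem hc, Set.indicator_of_mem, Pi.one_apply, mul_one]
      have hc' : (k : ℝ) + 1 / 2 - (∑ i, b i + ∑ i, c i) ∈ Set.Icc (0 : ℝ) 1 := hc
      exact ⟨by linarith [hc'.2], by linarith [hc'.1]⟩
    · rw [Set.indicator_of_notMem hc, Set.indicator_of_notMem, mul_zero]
      intro h
      apply hc
      have h' : ∑ i, c i ∈ Set.Icc ((k : ℝ) - 1 / 2 - ∑ i, b i)
        ((k : ℝ) - 1 / 2 - ∑ i, b i + 1) := h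
      exact ⟨by linarith [h'.2], by linarith [h'.1]⟩
  simp_rw [this]
  have hm : Measurable (fun c : Fin k → ℝ => ∑ i, c i) := by fun_prop
  have hS : MeasurableSet {c : Fin k → ℝ | ∑ i, c i ∈ Set.Icc ((k : ℝ) - 1 / 2 - ∑ i, b i)
        ((k : ℝ) - 1 / 2 - ∑ i, b i + 1)} := hm measurableSet_Icc
  rw [lintegral_const_mul _ (measurable_one.indicator hS), lintegral_indicator_one hS, mul_comm]
  gcongr
  exact anticonc k hk _

lemma cross_snd (k : ℕ) (hk : 0 < k) (H : (Fin k → ℝ) → ℝ≥0∞) (hH : Measurable H) :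
    ∫⁻ p in W k, H p.2 ∂((P k).prod (P k)) ≤ ENNReal.ofReal (3 / √k) * ∫⁻ b, H b ∂(P k) := by
  refine le_trans (le_of_eq ?_) (cross k hk H hH)
  have hs := (Measure.measurePreserving_swap (μ := P k) (ν := P k)).setLIntegral_comp_preimage
    (W_meas k) (f := fun p => H p.1) (hH.comp measurable_fst)
  rw [← hs]
  have : Prod.swap ⁻¹' (W k) = W k := by
    ext p
    simp only [W, Set.mem_preimage, Set.mem_ofPred_eq, Prod.fst_swap, Prod.snd_swap, add_comm]
  rw [this]
  rfl

/-- Centered indicator. -/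
noncomputable def ind (x u : ℝ) : ℝ := (if u ≤ x then 1 else 0) - x

lemma ind_meas (x : ℝ) : Measurable (ind x) :=
  (Measurable.ite measurableSet_Iic measurable_const measurable_const).sub measurable_const

lemma ind_abs (x u : ℝ) (hx : x ∈ Set.Icc (0 : ℝ) 1) : |ind x u| ≤ 1 := by
  unfold ind
  rw [abs_le]
  split_ifs <;> constructor <;> linarith [hx.1, hx.2]

lemma ind_mean (x : ℝ) (hx : x ∈ Set.Icc (0 : ℝ) 1) : ∫ u, ind x u ∂lam = 0 := by
  have h1 : (fun u : ℝ => if u ≤ x then (1 : ℝ) else 0) = (Set.Iic x).indicator 1 := by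
    ext u; simp [Set.indicator]
  unfold ind
  rw [integral_sub, h1, integral_indicator_one measurableSet_Iic]
  · have : Set.Iic x ∩ Set.Icc 0 1 = Set.Icc 0 x := by
      ext u; simp only [Set.mem_inter_iff, Set.mem_Iic, Set.mem_Icc]
      constructor
      · rintro ⟨h1, h2, h3⟩; exact ⟨h2, h1⟩
      · rintro ⟨h1, h2⟩; exact ⟨h2, h1, h2.trans hx.2⟩
    simp [lam, Measure.real, Measure.restrict_apply measurableSet_Iic, this, hx.1]
  · rw [h1]
    exact (integrable_const (1 : ℝ)).indicator measurableSet_Iic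
  · exact integrable_const _

lemma gDie_eq (n : ℕ) (A : Fin n → ℝ) (x : ℝ) : gDie n A x = ∑ i, ind x (A i) := by
  unfold gDie ind
  rw [Finset.sum_sub_distrib]
  simp

lemma gDie_extend (k : ℕ) (s : ℝ) (a : Fin (2 * k) → ℝ) (x : ℝ) :
    gDie (2 * k + 1) (extendDie (2 * k + 1) s a) x
      = ∑ i, ind x (a i) + ind x (s - ∑ j, a j) := by
  rw [gDie_eq, Fin.sum_univ_castSucc]
  congr 1
  · refine Finset.sum_congr rfl fun i _ => ?_
    congr 1
    simp [extendDie]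
  · congr 1
    simp [extendDie]

/-- Sum event. -/
def EvS (k : ℕ) : Set (Fin (2 * k) → ℝ) :=
  {a | (k : ℝ) + 1 / 2 - ∑ i, a i ∈ Set.Icc (0 : ℝ) 1}

lemma EvS_meas (k : ℕ) : MeasurableSet (EvS k) := by
  have : Measurable (fun p : (Fin (2 * k) → ℝ) => (k : ℝ) + 1 / 2 - ∑ i, p i) := by fun_prop
  exact this measurableSet_Icc

lemma glue_EvS (k : ℕ) : glue k ⁻¹' EvS k = W k := by
  ext p
  have := glue_sum k p id
  simp only [id] at this
  simp only [Set.mem_preimage, EvS, W, Set.mem_ofPred_eq, this]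

lemma EvS_eq (k : ℕ) : P (2 * k) (EvS k) = (P k).prod (P k) (W k) := by
  rw [← (glue_mp k).measure_preimage (EvS_meas k).nullMeasurableSet, glue_EvS]

lemma fixed_x (k : ℕ) (hk : 0 < k) (x : ℝ) (hx : x ∈ Set.Icc (0 : ℝ) 1) :
    ∫⁻ a in EvS k, ENNReal.ofReal
      (gDie (2 * k + 1) (extendDie (2 * k + 1) ((k : ℝ) + 1 / 2) a) x ^ 2) ∂(P (2 * k))
      ≤ ENNReal.ofReal (363 * k) * P (2 * k) (EvS k) := by
  have hk' : (0 : ℝ) < k := by exact_mod_cast hk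
  have hk1 : (1 : ℝ) ≤ k := by exact_mod_cast hk
  have hi : Measurable (ind x) := ind_meas x
  simp_rw [gDie_extend]
  rw [← (glue_mp k).setLIntegral_comp_preimage (EvS_meas k) (by fun_prop), glue_EvS, EvS_eq]
  set H : (Fin k → ℝ) → ℝ≥0∞ := fun b => ENNReal.ofReal ((∑ i, ind x (b i)) ^ 2) with hH
  have hHm : Measurable H := by fun_prop
  have hHint : ∫⁻ b, H b ∂(P k) ≤ k :=
    second_moment k (ind x) hi (fun u _ => ind_abs x u hx) (ind_mean x hx)
  have hpt : ∀ p : (Fin k → ℝ) × (Fin k → ℝ), ENNReal.ofReal ((∑ i, ind x (glue k p i) +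
      ind x ((k : ℝ) + 1 / 2 - ∑ j, glue k p j)) ^ 2) ≤ 3 * (H p.1 + H p.2 + 1) := by
    intro p
    rw [glue_sum k p (ind x)]
    have e : 3 * (H p.1 + H p.2 + 1) = ENNReal.ofReal
        (3 * ((∑ i, ind x (p.1 i)) ^ 2 + (∑ i, ind x (p.2 i)) ^ 2 + 1)) := by
      rw [ENNReal.ofReal_mul (by norm_num), ENNReal.ofReal_add (by positivity) (by norm_num),
        ENNReal.ofReal_add (by positivity) (by positivity)]
      simp [H]
    rw [e]
    apply ENNReal.ofReal_le_ofReal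
    have hl := (sq_le_one_iff_abs_le_one _).2
      (ind_abs x ((k : ℝ) + 1 / 2 - ∑ j, glue k p j) hx)
    generalize ∑ i, ind x (p.1 i) = r at *
    generalize ∑ i, ind x (p.2 i) = s at *
    generalize ind x ((k : ℝ) + 1 / 2 - ∑ j, glue k p j) = t at *
    nlinarith [sq_nonneg (r - s), sq_nonneg (r - t), sq_nonneg (s - t)]
  have hlow := lower k hk
  change 1 / (20 * √k) ≤ ((P k).prod (P k)).real (W k) at hlow
  set w := ((P k).prod (P k)).real (W k) with hw
  have hw' : (P k).prod (P k) (W k) = ENNReal.ofReal w := by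
    rw [hw, ofReal_measureReal]
  have hw0 : 0 ≤ w := measureReal_nonneg
  calc _ ≤ ∫⁻ p in W k, 3 * (H p.1 + H p.2 + 1) ∂((P k).prod (P k)) := lintegral_mono hpt
    _ = 3 * (∫⁻ p in W k, H p.1 ∂((P k).prod (P k)) + ∫⁻ p in W k, H p.2 ∂((P k).prod (P k))
        + (P k).prod (P k) (W k)) := by
        rw [lintegral_const_mul _ (by fun_prop), lintegral_add_left (by fun_prop),
          lintegral_add_left (by fun_prop)]
        simp
    _ ≤ 3 * (ENNReal.ofReal (3 / √k) * k + ENNReal.ofReal (3 / √k) * k + ENNReal.ofReal w) := by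
        rw [hw']
        gcongr
        · exact (cross k hk H hHm).trans (by gcongr)
        · exact (cross_snd k hk H hHm).trans (by gcongr)
    _ = ENNReal.ofReal (3 * (3 / √k * k + 3 / √k * k + w)) := by
        rw [ENNReal.ofReal_mul (by norm_num), ENNReal.ofReal_add (by positivity) hw0,
          ENNReal.ofReal_add (by positivity) (by positivity), ENNReal.ofReal_mul (by positivity)]
        simp
    _ ≤ ENNReal.ofReal (363 * k * w) := by
        apply ENNReal.ofReal_le_ofReal
        have h3 : 3 / √(k : ℝ) ≤ 60 * w := by
          have : 3 / √(k : ℝ) = 60 * (1 / (20 * √k)) := by field_simp; norm_num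
          rw [this]; gcongr
        have h4 : 3 / √(k : ℝ) * k ≤ 60 * w * k := by gcongr
        nlinarith
    _ = _ := by rw [hw', ← ENNReal.ofReal_mul (by positivity)]

lemma restrict_event (k : ℕ) : (volume : Measure (Fin (2 * k) → ℝ)).restrict
    {a | (∀ i, a i ∈ Set.Icc (0 : ℝ) 1) ∧ ((k : ℝ) + 1 / 2 - ∑ i, a i) ∈ Set.Icc (0 : ℝ) 1}
    = (P (2 * k)).restrict (EvS k) := by
  have : P (2 * k) = (volume : Measure (Fin (2 * k) → ℝ)).restrict
      (Set.univ.pi fun _ => Set.Icc (0 : ℝ) 1) := by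
    rw [volume_pi, Measure.restrict_pi_pi]; rfl
  rw [this, Measure.restrict_restrict (EvS_meas k)]
  congr 1
  ext a
  simp only [EvS, Set.mem_inter_iff, Set.mem_pi, Set.mem_ofPred_eq, Set.mem_univ, true_imp_iff]
  tauto

/-- The second moment as an extended nonnegative real. -/
noncomputable def GG (n : ℕ) (A : Fin n → ℝ) : ℝ≥0∞ :=
  ∫⁻ x, ENNReal.ofReal (gDie n A x ^ 2) ∂lam

lemma gDie_joint (n : ℕ) : Measurable (fun p : (Fin n → ℝ) × ℝ => gDie n p.1 p.2) := by
  simp_rw [gDie_eq, ind]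
  refine Finset.measurable_sum _ fun i _ => Measurable.sub ?_ measurable_snd
  refine Measurable.ite ?_ measurable_const measurable_const
  exact measurableSet_le (by fun_prop) (by fun_prop)

lemma GG_meas (n : ℕ) : Measurable (GG n) :=
  Measurable.lintegral_prod_right' (f := fun p : (Fin n → ℝ) × ℝ =>
    ENNReal.ofReal (gDie n p.1 p.2 ^ 2)) ((gDie_joint n).pow_const 2).ennreal_ofReal

lemma var_le (n : ℕ) (A : Fin n → ℝ) :
    ENNReal.ofReal (varDie n A - 12 * cvDie n A ^ 2) ≤ GG n A := by
  have h1 : varDie n A - 12 * cvDie n A ^ 2 ≤ ∫ x, gDie n A x ^ 2 ∂lam := by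
    unfold varDie
    have : mean01 (fun x => gDie n A x ^ 2) = ∫ x, gDie n A x ^ 2 ∂lam := rfl
    rw [this]
    nlinarith [sq_nonneg (mean01 (gDie n A)), sq_nonneg (cvDie n A)]
  have hm : Measurable (fun x => gDie n A x ^ 2) :=
    ((gDie_joint n).comp (measurable_const.prodMk measurable_id)).pow_const 2
  rw [integral_eq_lintegral_of_nonneg_ae (Filter.Eventually.of_forall fun x => sq_nonneg _)
    hm.aestronglyMeasurable] at h1
  exact (ENNReal.ofReal_le_ofReal h1).trans ENNReal.ofReal_toReal_le

lemma extend_meas (n : ℕ) (s : ℝ) : Measurable (extendDie n s) := by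
  refine measurable_pi_lambda _ fun i => ?_
  unfold extendDie
  by_cases h : (i : ℕ) < n - 1
  · simp only [h, dite_true]; fun_prop
  · simp only [h, dite_false]; fun_prop

lemma mean_bound (k : ℕ) (hk : 0 < k) :
    ∫⁻ A, GG (2 * k + 1) A ∂(diceMeasure (2 * k + 1) 0 1 ((k : ℝ) + 1 / 2))
      ≤ ENNReal.ofReal (363 * k) := by
  unfold diceMeasure
  rw [lintegral_map (GG_meas _) (extend_meas _ _), ProbabilityTheory.cond, lintegral_smul_measure]
  change _ • ∫⁻ a : Fin (2 * k) → ℝ, GG (2 * k + 1) (extendDie (2 * k + 1) ((k : ℝ) + 1 / 2) a)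
    ∂((volume : Measure (Fin (2 * k) → ℝ)).restrict {a | (∀ i, a i ∈ Set.Icc (0 : ℝ) 1) ∧
      ((k : ℝ) + 1 / 2 - ∑ i, a i) ∈ Set.Icc (0 : ℝ) 1}) ≤ _
  have hv : (volume : Measure (Fin (2 * k) → ℝ)) {a | (∀ i, a i ∈ Set.Icc (0 : ℝ) 1) ∧
      ((k : ℝ) + 1 / 2 - ∑ i, a i) ∈ Set.Icc (0 : ℝ) 1} = P (2 * k) (EvS k) := by
    rw [← Measure.restrict_apply_self, restrict_event]
    have := congrArg (fun μ => μ Set.univ) (restrict_event k)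
    simp only [Measure.restrict_apply_univ] at this
    rw [← this, ← restrict_event, Measure.restrict_apply_self]
  change (volume {a : Fin (2 * k) → ℝ | (∀ i, a i ∈ Set.Icc (0 : ℝ) 1) ∧
      ((k : ℝ) + 1 / 2 - ∑ i, a i) ∈ Set.Icc (0 : ℝ) 1})⁻¹ • _ ≤ _
  rw [hv, restrict_event]
  unfold GG
  have hj : Measurable (fun p : (Fin (2 * k) → ℝ) × ℝ => ENNReal.ofReal
      (gDie (2 * k + 1) (extendDie (2 * k + 1) ((k : ℝ) + 1 / 2) p.1) p.2 ^ 2)) :=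
    (((gDie_joint (2 * k + 1)).comp (((extend_meas (2 * k + 1) ((k : ℝ) + 1 / 2)).comp
      measurable_fst).prodMk measurable_snd)).pow_const 2).ennreal_ofReal
  rw [lintegral_lintegral_swap hj.aemeasurable]
  have hle : ∫⁻ x, ∫⁻ a in EvS k, ENNReal.ofReal
      (gDie (2 * k + 1) (extendDie (2 * k + 1) ((k : ℝ) + 1 / 2) a) x ^ 2) ∂(P (2 * k)) ∂lam
      ≤ ∫⁻ x, ENNReal.ofReal (363 * k) * P (2 * k) (EvS k) ∂lam := by
    unfold lam
    exact setLIntegral_mono' measurableSet_Icc fun x hx => fixed_x k hk x hx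
  rw [lintegral_const, measure_univ, mul_one] at hle
  rw [smul_eq_mul]
  calc _ ≤ (P (2 * k) (EvS k))⁻¹ * (ENNReal.ofReal (363 * k) * P (2 * k) (EvS k)) := by gcongr
    _ = ENNReal.ofReal (363 * k) * ((P (2 * k) (EvS k))⁻¹ * P (2 * k) (EvS k)) := by ring
    _ ≤ ENNReal.ofReal (363 * k) * 1 := by gcongr; exact ENNReal.inv_mul_le_one _
    _ = _ := mul_one _

end DiceAux

theorem var_cond_upper_bound :
    ∀ ε > (0 : ℝ), ∃ K > (0 : ℝ), ∃ N : ℕ, ∀ n : ℕ, N ≤ n → Odd n →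
      (diceMeasure n 0 1 ((n : ℝ) / 2))
          {A : Fin n → ℝ | varDie n A - 12 * cvDie n A ^ 2 > K * n}
        < ENNReal.ofReal ε := by
  intro ε hε
  refine ⟨363 / ε, by positivity, 3, ?_⟩
  rintro n hn ⟨k, rfl⟩
  have hk : 0 < k := by omega
  have hk' : (0 : ℝ) < k := by exact_mod_cast hk
  have hs : ((2 * k + 1 : ℕ) : ℝ) / 2 = (k : ℝ) + 1 / 2 := by push_cast; ring
  rw [hs]
  set t : ℝ := 363 / ε * ((2 * k + 1 : ℕ) : ℝ) with ht
  have ht0 : 0 < t := by positivity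
  have hmk := meas_ge_le_lintegral_div
    (μ := diceMeasure (2 * k + 1) 0 1 ((k : ℝ) + 1 / 2)) (DiceAux.GG_meas (2 * k + 1)).aemeasurable
    (ε := ENNReal.ofReal t) (by simpa using ht0) ENNReal.ofReal_ne_top
  have hsub : {A : Fin (2 * k + 1) → ℝ | varDie (2 * k + 1) A - 12 * cvDie (2 * k + 1) A ^ 2 > t} ⊆
      {A | ENNReal.ofReal t ≤ DiceAux.GG (2 * k + 1) A} := by
    intro A hA
    exact (ENNReal.ofReal_le_ofReal (le_of_lt hA)).trans (DiceAux.var_le _ A)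
  calc _ ≤ _ := measure_mono hsub
    _ ≤ _ := hmk
    _ ≤ ENNReal.ofReal (363 * k) / ENNReal.ofReal t := by
        gcongr; exact DiceAux.mean_bound k hk
    _ = ENNReal.ofReal (363 * k / t) := (ENNReal.ofReal_div_of_pos ht0).symm
    _ < ENNReal.ofReal ε := by
        rw [ENNReal.ofReal_lt_ofReal_iff hε, div_lt_iff₀ ht0, ht]
        have : ε * (363 / ε * ((2 * k + 1 : ℕ) : ℝ)) = 363 * ((2 * k + 1 : ℕ) : ℝ) := by
          field_simp
        rw [this]
        push_cast
        linarith
end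

section
/- There exist ε > 0 and N such that for every odd n ≥ N: the μ_n⊗μ_n-measure of the set of pairs (A,B) with |CV_{AB} − 12·CV_A·CV_B| > ε·n is greater than ε. -/
open MeasureTheory ProbabilityTheory Set
open scoped ENNReal NNReal

/-- `CV_{AB} = Cov(g_A(V), g_B(V))`. -/
noncomputable def cvDie₂ (n : ℕ) (A B : Fin n → ℝ) : ℝ :=
  mean01 (fun x => gDie n A x * gDie n B x) - mean01 (gDie n A) * mean01 (gDie n B)

section Moments

variable {Ω : Type*} [MeasurableSpace Ω]

/-- A function that changes sign under a measure preserving map has zero integral. -/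
lemma integral_zero_of_flip {P : Measure Ω} {τ : Ω → Ω} (hτ : MeasurePreserving τ P P)
    {f : Ω → ℝ} (hf : Measurable f) (h : ∀ x, f (τ x) = - f x) : ∫ x, f x ∂P = 0 := by
  have h1 : ∫ x, f x ∂P = ∫ x, f (τ x) ∂P := by
    conv_lhs => rw [← hτ.map_eq]
    rw [integral_map hτ.measurable.aemeasurable hf.aestronglyMeasurable]
  simp only [h, integral_neg] at h1
  linarith

/-- bounded measurable functions -/
def BM (f : Ω → ℝ) : Prop := Measurable f ∧ ∃ C, ∀ x, |f x| ≤ C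

lemma BM.add {f g : Ω → ℝ} (hf : BM f) (hg : BM g) : BM (fun x => f x + g x) := by
  obtain ⟨hf, C, hC⟩ := hf
  obtain ⟨hg, D, hD⟩ := hg
  exact ⟨hf.add hg, C + D, fun x => (abs_add_le _ _).trans (add_le_add (hC x) (hD x))⟩

lemma BM.mul {f g : Ω → ℝ} (hf : BM f) (hg : BM g) : BM (fun x => f x * g x) := by
  obtain ⟨hf, C, hC⟩ := hf
  obtain ⟨hg, D, hD⟩ := hg
  refine ⟨hf.mul hg, C * D, fun x => ?_⟩
  rw [abs_mul]
  exact mul_le_mul (hC x) (hD x) (abs_nonneg _) ((abs_nonneg _).trans (hC x))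

lemma BM.const (c : ℝ) : BM (fun _ : Ω => c) := ⟨measurable_const, |c|, fun _ => le_rfl⟩

lemma BM.pow {f : Ω → ℝ} (hf : BM f) (k : ℕ) : BM (fun x => f x ^ k) := by
  induction k with
  | zero => simpa using BM.const (Ω := Ω) 1
  | succ k ih => simpa only [pow_succ] using ih.mul hf

lemma BM.sum {ι : Type*} {f : ι → Ω → ℝ} (hf : ∀ i, BM (f i)) (S : Finset ι) :
    BM (fun x => ∑ i ∈ S, f i x) := by
  classical
  induction S using Finset.induction_on with
  | empty => simpa using BM.const (Ω := Ω) 0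
  | insert i S hi ih => simpa only [Finset.sum_insert hi] using (hf i).add ih

lemma BM.integrable {P : Measure Ω} [IsFiniteMeasure P] {f : Ω → ℝ} (hf : BM f) :
    Integrable f P := by
  obtain ⟨hf, C, hC⟩ := hf
  exact Integrable.of_bound hf.aestronglyMeasurable C (Filter.Eventually.of_forall hC)

lemma second_moment {P : Measure Ω} [IsFiniteMeasure P] {ι : Type*}
    {f : ι → Ω → ℝ} (hf : ∀ i, BM (f i)) {τ : ι → Ω → Ω}
    (hτ : ∀ i, MeasurePreserving (τ i) P P) (hneg : ∀ i x, f i (τ i x) = - f i x)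
    (hinv : ∀ i j x, j ≠ i → f j (τ i x) = f j x) {w : Ω → ℝ} (hw : BM w) (S : Finset ι)
    (hwS : ∀ i ∈ S, ∀ x, w (τ i x) = w x) :
    ∫ x, (∑ i ∈ S, f i x) ^ 2 * w x ∂P = ∑ i ∈ S, ∫ x, f i x ^ 2 * w x ∂P := by
  classical
  induction S using Finset.induction_on with
  | empty => simp
  | insert i S hi ih =>
    have hG := BM.sum hf S
    rw [Finset.sum_insert hi, ← ih (fun j hj => hwS j (Finset.mem_insert_of_mem hj))]
    have e : ∀ x, (∑ j ∈ insert i S, f j x) ^ 2 * w x =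
        (f i x ^ 2 * w x + (∑ j ∈ S, f j x) ^ 2 * w x)
          + 2 * (f i x * (∑ j ∈ S, f j x) * w x) := by
      intro x; rw [Finset.sum_insert hi]; ring
    have hz : ∫ x, 2 * (f i x * (∑ j ∈ S, f j x) * w x) ∂P = 0 := by
      refine integral_zero_of_flip (hτ i) ((BM.const 2).mul (((hf i).mul hG).mul hw)).1 ?_
      intro x
      have : ∑ j ∈ S, f j (τ i x) = ∑ j ∈ S, f j x :=
        Finset.sum_congr rfl fun j hj => hinv i j x (fun h => hi (h ▸ hj))
      rw [this, hneg, hwS i (Finset.mem_insert_self _ _)]; ring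
    simp only [e]
    rw [integral_add, integral_add, hz, add_zero]
    · exact (((hf i).pow 2).mul hw).integrable
    · exact ((hG.pow 2).mul hw).integrable
    · exact ((((hf i).pow 2).mul hw).add ((hG.pow 2).mul hw)).integrable
    · exact ((BM.const 2).mul (((hf i).mul hG).mul hw)).integrable

lemma fourth_moment {P : Measure Ω} [IsFiniteMeasure P] {ι : Type*}
    {f : ι → Ω → ℝ} (hf : ∀ i, BM (f i)) {τ : ι → Ω → Ω}
    (hτ : ∀ i, MeasurePreserving (τ i) P P) (hneg : ∀ i x, f i (τ i x) = - f i x)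
    (hinv : ∀ i j x, j ≠ i → f j (τ i x) = f j x) {D : ℝ}
    (hD : ∀ i, ∫ x, f i x ^ 4 ∂P ≤ D) (hD0 : 0 ≤ D) (S : Finset ι) :
    ∫ x, (∑ i ∈ S, f i x) ^ 4 ∂P ≤ 3 * D * (S.card : ℝ) ^ 2 := by
  classical
  induction S using Finset.induction_on with
  | empty => simp
  | insert i S hi ih =>
    have hG := BM.sum hf S
    have e : ∀ x, (∑ j ∈ insert i S, f j x) ^ 4 =
        (((∑ j ∈ S, f j x) ^ 4 + f i x ^ 4) + 6 * ((∑ j ∈ S, f j x) ^ 2 * f i x ^ 2))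
          + 4 * (f i x * (∑ j ∈ S, f j x) * ((∑ j ∈ S, f j x) ^ 2 + f i x ^ 2)) := by
      intro x; rw [Finset.sum_insert hi]; ring
    have b1 := (hG.pow 4).add ((hf i).pow 4)
    have b2 := (BM.const 6).mul ((hG.pow 2).mul ((hf i).pow 2))
    have b3 := (BM.const 4).mul (((hf i).mul hG).mul ((hG.pow 2).add ((hf i).pow 2)))
    have hz : ∫ x, 4 * (f i x * (∑ j ∈ S, f j x) * ((∑ j ∈ S, f j x) ^ 2 + f i x ^ 2)) ∂P
        = 0 := by
      refine integral_zero_of_flip (hτ i) b3.1 ?_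
      intro x
      have : ∑ j ∈ S, f j (τ i x) = ∑ j ∈ S, f j x :=
        Finset.sum_congr rfl fun j hj => hinv i j x (fun h => hi (h ▸ hj))
      rw [this, hneg]; ring
    have hmid : ∫ x, (∑ j ∈ S, f j x) ^ 2 * f i x ^ 2 ∂P ≤ S.card * D := by
      rw [second_moment hf hτ hneg hinv ((hf i).pow 2) S
        (fun j hj x => by rw [hinv j i x (fun h => hi (h ▸ hj))]), ← nsmul_eq_mul]
      refine Finset.sum_le_card_nsmul _ _ _ fun j hj => ?_
      have : ∫ x, f j x ^ 2 * f i x ^ 2 ∂P ≤ ∫ x, (1/2) * (f j x ^ 4 + f i x ^ 4) ∂P := by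
        refine integral_mono (((hf j).pow 2).mul ((hf i).pow 2)).integrable
          ((BM.const (1/2)).mul (((hf j).pow 4).add ((hf i).pow 4))).integrable fun x => ?_
        change f j x ^ 2 * f i x ^ 2 ≤ (1/2) * (f j x ^ 4 + f i x ^ 4)
        nlinarith [sq_nonneg (f j x ^ 2 - f i x ^ 2)]
      rw [integral_const_mul, integral_add ((hf j).pow 4).integrable ((hf i).pow 4).integrable]
        at this
      linarith [hD i, hD j]
    simp only [e]
    rw [integral_add (b1.add b2).integrable b3.integrable, hz, add_zero,
      integral_add b1.integrable b2.integrable,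
      integral_add (hG.pow 4).integrable ((hf i).pow 4).integrable, integral_const_mul,
      Finset.card_insert_of_notMem hi]
    push_cast
    nlinarith [hD i]

/-- Paley–Zygmund. -/
lemma paley_zygmund {P : Measure Ω} [IsProbabilityMeasure P] {X : Ω → ℝ} (hX : BM X)
    {m C : ℝ} (hm : 0 < m) (hC : 0 < C) (h2 : m ≤ ∫ x, X x ^ 2 ∂P)
    (h4 : ∫ x, X x ^ 4 ∂P ≤ C) :
    m ^ 2 / (4 * C) ≤ P.real {x | m / 2 < X x ^ 2} := by
  have hS : MeasurableSet {x | m / 2 < X x ^ 2} :=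
    measurableSet_lt measurable_const (hX.1.pow_const 2)
  set S := {x | m / 2 < X x ^ 2} with hSdef
  have hI : BM (S.indicator (fun _ => (1:ℝ))) :=
    ⟨measurable_const.indicator hS, 1, fun x => by
      by_cases hx : x ∈ S <;> simp [hx]⟩
  have key : ∀ x, X x ^ 2 ≤ m / 2 + (m / (4 * C)) * X x ^ 4
      + (C / m) * S.indicator (fun _ => (1:ℝ)) x := by
    intro x
    by_cases hx : x ∈ S
    · simp only [hx, indicator_of_mem, mul_one]
      have : (m / (4 * C)) * X x ^ 4 + C / m - X x ^ 2
          = (m * X x ^ 2 - 2 * C) ^ 2 / (4 * C * m) := by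
        field_simp; ring
      have h0 : 0 ≤ (m * X x ^ 2 - 2 * C) ^ 2 / (4 * C * m) := by positivity
      linarith
    · simp only [hx, not_false_eq_true, indicator_of_notMem, mul_zero, add_zero]
      have : X x ^ 2 ≤ m / 2 := not_lt.1 hx
      have h0 : 0 ≤ (m / (4 * C)) * X x ^ 4 := by positivity
      linarith
  have b1 := (BM.const (Ω := Ω) (m / 2)).add ((BM.const (m / (4 * C))).mul (hX.pow 4))
  have b2 := (BM.const (Ω := Ω) (C / m)).mul hI
  have h := integral_mono (μ := P) (hX.pow 2).integrable (b1.add b2).integrable key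
  rw [integral_add b1.integrable b2.integrable,
    integral_add (BM.const (m / 2)).integrable ((BM.const (m / (4 * C))).mul (hX.pow 4)).integrable,
    integral_const_mul, integral_const_mul, integral_const, integral_indicator_const _ hS] at h
  simp only [probReal_univ, smul_eq_mul, one_mul, mul_one] at h
  have h5 : m / (4 * C) * ∫ x, X x ^ 4 ∂P ≤ m / 4 := by
    calc _ ≤ m / (4 * C) * C := by gcongr
      _ = m / 4 := by field_simp
  have h6 : m / 4 ≤ C / m * P.real S := by linarith
  calc m ^ 2 / (4 * C) = (m / C) * (m / 4) := by field_simp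
    _ ≤ (m / C) * (C / m * P.real S) := by gcongr
    _ = P.real S := by field_simp

end Moments

/-- Modify a measure preserving map off an invariant set. -/
lemma mp_piecewise {α : Type*} [MeasurableSpace α] {μ : Measure α} {g : α → α}
    (hg : MeasurePreserving g μ μ) {S : Set α} [DecidablePred (· ∈ S)] (hS : MeasurableSet S)
    (hinv : g ⁻¹' S = S) : MeasurePreserving (S.piecewise g id) μ μ := by
  refine ⟨Measurable.piecewise hS hg.measurable measurable_id, ?_⟩
  ext U hU
  rw [Measure.map_apply (Measurable.piecewise hS hg.measurable measurable_id) hU,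
    ← measure_inter_add_sdiff _ hS, ← measure_inter_add_sdiff U hS]
  congr 1
  · rw [← hg.measure_preimage (hU.inter hS).nullMeasurableSet, preimage_inter, hinv]
    congr 1
    ext x
    by_cases hx : x ∈ S <;> simp [hx]
  · congr 1
    ext x
    by_cases hx : x ∈ S <;> simp [hx]

/-- The region where the flip acts. -/
def flipR : Set (ℝ × ℝ) := Icc (1/2) 1 ×ˢ Icc 0 (1/2)

open Classical in
/-- The sum preserving flip of a pair. -/
noncomputable def pairFlip : ℝ × ℝ → ℝ × ℝ :=
  flipR.piecewise (fun z => (z.2 + 1/2, z.1 - 1/2)) id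

lemma measurableSet_flipR : MeasurableSet flipR := measurableSet_Icc.prod measurableSet_Icc

lemma flipR_inv (z : ℝ × ℝ) : (z.2 + 1/2, z.1 - 1/2) ∈ flipR ↔ z ∈ flipR := by
  simp only [flipR, mem_prod, mem_Icc]
  constructor <;> rintro ⟨⟨h1, h2⟩, h3, h4⟩ <;> refine ⟨⟨?_, ?_⟩, ?_, ?_⟩ <;> linarith

open Classical in
lemma pairFlip_mp : MeasurePreserving pairFlip volume volume := by
  unfold pairFlip
  refine mp_piecewise ?_ measurableSet_flipR ?_
  · have h1 : MeasurePreserving (Prod.swap : ℝ × ℝ → ℝ × ℝ) volume volume :=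
      Measure.measurePreserving_swap
    have h2 := (measurePreserving_add_right (volume : Measure (ℝ × ℝ)) (1/2, -(1/2))).comp h1
    convert h2 using 1
    funext z
    ext <;> simp [sub_eq_add_neg]
  · ext z; exact flipR_inv z

lemma pairFlip_of_mem {z : ℝ × ℝ} (h : z ∈ flipR) : pairFlip z = (z.2 + 1/2, z.1 - 1/2) := by
  simp [pairFlip, h]

lemma pairFlip_of_notMem {z : ℝ × ℝ} (h : z ∉ flipR) : pairFlip z = z := by
  simp [pairFlip, h]

lemma pairFlip_flip (z : ℝ × ℝ) : pairFlip (pairFlip z) = z := by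
  by_cases h : z ∈ flipR
  · rw [pairFlip_of_mem h, pairFlip_of_mem ((flipR_inv z).2 h)]; ext <;> simp
  · rw [pairFlip_of_notMem h, pairFlip_of_notMem h]

lemma pairFlip_sum (z : ℝ × ℝ) : (pairFlip z).1 + (pairFlip z).2 = z.1 + z.2 := by
  by_cases h : z ∈ flipR
  · rw [pairFlip_of_mem h]; simp only; ring
  · rw [pairFlip_of_notMem h]

lemma pairFlip_mem (z : ℝ × ℝ) (h : z.1 ∈ Icc (0:ℝ) 1 ∧ z.2 ∈ Icc (0:ℝ) 1) :
    (pairFlip z).1 ∈ Icc (0:ℝ) 1 ∧ (pairFlip z).2 ∈ Icc (0:ℝ) 1 := by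
  by_cases h' : z ∈ flipR
  · rw [pairFlip_of_mem h']
    simp only [flipR, mem_prod, mem_Icc] at *
    obtain ⟨⟨h1, h2⟩, h3, h4⟩ := h'
    refine ⟨⟨?_, ?_⟩, ?_, ?_⟩ <;> linarith
  · rwa [pairFlip_of_notMem h']

/-- The `k`-th pair. -/
def pr {K : ℕ} (a : Fin (K + K) → ℝ) (k : Fin K) : ℝ × ℝ := (a (Fin.castAdd K k), a (Fin.natAdd K k))

/-- Flip the pairs with index in `S`. -/
noncomputable def dflip {K : ℕ} (S : Finset (Fin K)) (a : Fin (K + K) → ℝ) : Fin (K + K) → ℝ :=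
  Fin.addCases (fun k => if k ∈ S then (pairFlip (pr a k)).1 else a (Fin.castAdd K k))
    (fun k => if k ∈ S then (pairFlip (pr a k)).2 else a (Fin.natAdd K k))

lemma pr_dflip {K : ℕ} (S : Finset (Fin K)) (a : Fin (K + K) → ℝ) (k : Fin K) :
    pr (dflip S a) k = if k ∈ S then pairFlip (pr a k) else pr a k := by
  by_cases h : k ∈ S <;> simp [pr, dflip, h, -Fin.natAdd_eq_addNat]

lemma sum_pr {K : ℕ} (a : Fin (K + K) → ℝ) (f : ℝ → ℝ) :
    ∑ i, f (a i) = ∑ k, (f (pr a k).1 + f (pr a k).2) := by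
  rw [Fin.sum_univ_add, ← Finset.sum_add_distrib]; rfl

lemma dflip_sum {K : ℕ} (S : Finset (Fin K)) (a : Fin (K + K) → ℝ) :
    ∑ i, dflip S a i = ∑ i, a i := by
  rw [sum_pr (dflip S a) (fun x => x), sum_pr a (fun x => x)]
  refine Finset.sum_congr rfl fun k _ => ?_
  rw [pr_dflip]
  split_ifs
  · exact pairFlip_sum _
  · rfl

lemma dflip_dflip {K : ℕ} (S : Finset (Fin K)) (a : Fin (K + K) → ℝ) :
    dflip S (dflip S a) = a := by
  have : ∀ k, pr (dflip S (dflip S a)) k = pr a k := by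
    intro k
    rw [pr_dflip, pr_dflip]
    split_ifs
    · exact pairFlip_flip _
    · rfl
  ext i
  refine Fin.addCases (fun k => ?_) (fun k => ?_) i
  · exact congrArg Prod.fst (this k)
  · exact congrArg Prod.snd (this k)

lemma forall_pr {K : ℕ} (a : Fin (K + K) → ℝ) (p : ℝ → Prop) :
    (∀ i, p (a i)) ↔ ∀ k, p (pr a k).1 ∧ p (pr a k).2 := by
  constructor
  · intro h k; exact ⟨h _, h _⟩
  · intro h i
    refine Fin.addCases (fun k => ?_) (fun k => ?_) i
    · exact (h k).1
    · exact (h k).2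

lemma dflip_mp {K : ℕ} (S : Finset (Fin K)) : MeasurePreserving (dflip S) volume volume := by
  let e1 := MeasurableEquiv.piCongrLeft (fun _ : Fin (K + K) => ℝ) finSumFinEquiv
  have h1 : MeasurePreserving e1 volume volume :=
    volume_measurePreserving_piCongrLeft (fun _ : Fin (K + K) => ℝ) finSumFinEquiv
  let e2 := MeasurableEquiv.sumPiEquivProdPi (fun _ : Fin K ⊕ Fin K => ℝ)
  have h2 : MeasurePreserving e2 volume volume :=
    volume_measurePreserving_sumPiEquivProdPi (fun _ : Fin K ⊕ Fin K => ℝ)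
  let e3 := MeasurableEquiv.arrowProdEquivProdArrow ℝ ℝ (Fin K)
  have h3 : MeasurePreserving e3 volume volume :=
    volume_measurePreserving_arrowProdEquivProdArrow ℝ ℝ (Fin K)
  let F : (Fin K → ℝ × ℝ) → (Fin K → ℝ × ℝ) :=
    fun x k => (if k ∈ S then pairFlip else id) (x k)
  have hF : MeasurePreserving F volume volume := by
    refine volume_preserving_pi (fun k => ?_)
    split_ifs
    · exact pairFlip_mp
    · exact MeasurePreserving.id _
  have hh := ((h1.comp h2.symm).comp h3).comp (hF.comp (((h3.symm).comp h2).comp h1.symm))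
  convert hh using 1
  funext a
  have hx : ∀ x : Fin K → ℝ × ℝ, (e1 (e2.symm (e3 x))) = Fin.addCases (fun k => (x k).1) (fun k => (x k).2) := by
    intro x
    ext i
    refine Fin.addCases (fun k => ?_) (fun k => ?_) i
    · rw [Fin.addCases_left, ← finSumFinEquiv_apply_left]
      exact MeasurableEquiv.piCongrLeft_apply_apply ..
    · rw [Fin.addCases_right, ← finSumFinEquiv_apply_right]
      exact MeasurableEquiv.piCongrLeft_apply_apply ..
  have hy : e3.symm (e2 (e1.symm a)) = pr a := by
    apply e3.injective
    apply e2.symm.injective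
    apply e1.injective
    rw [hx (pr a)]
    rw [e3.apply_symm_apply, e2.symm_apply_apply, e1.apply_symm_apply]
    ext i
    refine Fin.addCases (fun k => ?_) (fun k => ?_) i <;> simp [pr, -Fin.natAdd_eq_addNat]
  simp only [Function.comp]
  rw [hx, hy]
  ext i
  refine Fin.addCases (fun k => ?_) (fun k => ?_) i
  · by_cases h : k ∈ S <;> simp [dflip, F, h, pr, -Fin.natAdd_eq_addNat]
  · by_cases h : k ∈ S <;> simp [dflip, F, h, pr, -Fin.natAdd_eq_addNat]

/-- The conditioning event. -/
def ev (K : ℕ) : Set (Fin (K + K) → ℝ) :=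
  {a | (∀ i, a i ∈ Set.Icc (0:ℝ) 1) ∧ (((K + K + 1 : ℕ) : ℝ) / 2 - ∑ i, a i) ∈ Set.Icc (0:ℝ) 1}

lemma measurableSet_ev (K : ℕ) : MeasurableSet (ev K) := by
  have h1 : MeasurableSet {a : Fin (K + K) → ℝ | ∀ i, a i ∈ Set.Icc (0:ℝ) 1} := by
    rw [Set.ofPred_forall]
    exact MeasurableSet.iInter fun i => measurableSet_Icc.preimage (measurable_pi_apply i)
  have h2 : Measurable (fun a : Fin (K + K) → ℝ => ((K + K + 1 : ℕ) : ℝ) / 2 - ∑ i, a i) := by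
    fun_prop
  exact h1.inter (h2 measurableSet_Icc)

lemma ev_subset (K : ℕ) : ev K ⊆ Set.Icc 0 1 := fun _ ha =>
  ⟨fun i => (ha.1 i).1, fun i => (ha.1 i).2⟩

lemma ev_ne_top (K : ℕ) : volume (ev K) ≠ ⊤ :=
  ((measure_mono (ev_subset K)).trans_lt isCompact_Icc.measure_lt_top).ne

lemma ev_ne_zero (K : ℕ) (hK : 0 < K) : volume (ev K) ≠ 0 := by
  have hK' : (1:ℝ) ≤ K := by exact_mod_cast hK
  have hsub : Metric.closedBall (fun _ : Fin (K + K) => (1/2:ℝ)) (1 / (4 * K)) ⊆ ev K := by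
    intro a ha
    rw [mem_closedBall_iff_norm, pi_norm_le_iff_of_nonneg (by positivity)] at ha
    have ha' : ∀ i, |a i - 1/2| ≤ 1 / (4 * K) := fun i => by simpa using ha i
    have h4 : 1 / (4 * (K:ℝ)) ≤ 1/2 := by
      rw [div_le_div_iff₀ (by positivity) (by positivity)]; linarith
    refine ⟨fun i => ?_, ?_⟩
    · have := abs_le.1 ((ha' i).trans h4)
      constructor <;> linarith [this.1, this.2]
    · have hs : |∑ i, (a i - 1/2)| ≤ 1/2 := by
        calc |∑ i, (a i - 1/2)| ≤ ∑ i, |a i - 1/2| := Finset.abs_sum_le_sum_abs _ _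
          _ ≤ ∑ _i : Fin (K + K), 1 / (4 * (K:ℝ)) := Finset.sum_le_sum fun i _ => ha' i
          _ = 1/2 := by simp; field_simp; norm_num
      rw [Finset.sum_sub_distrib] at hs
      simp only [Finset.sum_const, Finset.card_univ, Fintype.card_fin, nsmul_eq_mul] at hs
      push_cast at hs ⊢
      have := abs_le.1 hs
      constructor <;> linarith [this.1, this.2]
  exact fun h => (Metric.measure_closedBall_pos volume (fun _ : Fin (K + K) => (1/2:ℝ))
    (by positivity : 0 < 1 / (4 * (K:ℝ)))).ne' (measure_mono_null hsub h)

/-- The conditioned measure. -/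
noncomputable def nuM (K : ℕ) : Measure (Fin (K + K) → ℝ) := ProbabilityTheory.cond volume (ev K)

lemma nuM_prob (K : ℕ) (hK : 0 < K) : IsProbabilityMeasure (nuM K) :=
  cond_isProbabilityMeasure_of_finite (ev_ne_zero K hK) (ev_ne_top K)

lemma dflip_mem_ev {K : ℕ} (S : Finset (Fin K)) {a : Fin (K + K) → ℝ} (ha : a ∈ ev K) :
    dflip S a ∈ ev K := by
  refine ⟨?_, ?_⟩
  · rw [forall_pr (dflip S a) (fun x => x ∈ Icc (0:ℝ) 1)]
    have h := (forall_pr a (fun x => x ∈ Icc (0:ℝ) 1)).1 ha.1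
    intro k
    rw [pr_dflip]
    split_ifs
    · exact pairFlip_mem _ (h k)
    · exact h k
  · rw [dflip_sum]; exact ha.2

lemma dflip_nu {K : ℕ} (S : Finset (Fin K)) : MeasurePreserving (dflip S) (nuM K) (nuM K) := by
  have h := (dflip_mp S).restrict_preimage (measurableSet_ev K)
  have e : dflip S ⁻¹' (ev K) = ev K := by
    ext a
    constructor
    · intro h
      have := dflip_mem_ev S h
      rwa [dflip_dflip] at this
    · exact fun h => dflip_mem_ev S h
  rw [e] at h
  exact h.smul_measure _

lemma nu_ae (K : ℕ) : ∀ᵐ a ∂(nuM K), a ∈ ev K :=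
  ae_cond_mem (measurableSet_ev K)

/-- Boxes for the `k`-th pair. -/
def bx {K : ℕ} (k : Fin K) (u v : ℝ) : Set (Fin (K + K) → ℝ) :=
  {a | (pr a k).1 ∈ Icc u (u + 1/16) ∧ (pr a k).2 ∈ Icc v (v + 1/16)}

open scoped Pointwise in
lemma box_compare {K : ℕ} (hK : 8 ≤ K) (k : Fin K) {u v u' v' : ℝ}
    (hu : u ∈ Icc (0:ℝ) (15/16)) (hv : v ∈ Icc (0:ℝ) (15/16))
    (hu' : u' ∈ Icc (0:ℝ) (15/16)) (hv' : v' ∈ Icc (0:ℝ) (15/16)) :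
    ENNReal.ofReal (Real.exp (-16)) * volume (ev K ∩ bx k u v) ≤ volume (ev K ∩ bx k u' v') := by
  have hK' : (8:ℝ) ≤ K := by exact_mod_cast hK
  obtain ⟨l, hl⟩ : ∃ l : ℝ, l = 4 / K := ⟨_, rfl⟩
  have hl0 : 0 < l := by rw [hl]; positivity
  have hl1 : l ≤ 1/2 := by rw [hl, div_le_iff₀ (by positivity)]; linarith
  have hlK : l * K = 4 := by rw [hl]; field_simp
  obtain ⟨wi, hwi⟩ : ∃ w : ℝ, w = u' - (1 - l) * u := ⟨_, rfl⟩
  obtain ⟨wj, hwj⟩ : ∃ w : ℝ, w = v' - (1 - l) * v := ⟨_, rfl⟩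
  have hwib : wi ∈ Icc (-1:ℝ) 1 := by
    rw [hwi]; constructor <;> nlinarith [hu.1, hu.2, hu'.1, hu'.2]
  have hwjb : wj ∈ Icc (-1:ℝ) 1 := by
    rw [hwj]; constructor <;> nlinarith [hv.1, hv.2, hv'.1, hv'.2]
  obtain ⟨z, hz⟩ : ∃ z : ℝ, z = (4 + l / 2 - wi - wj) / (8 - 2 * l) := ⟨_, rfl⟩
  have hden : 0 < 8 - 2 * l := by linarith
  have hz0 : 0 ≤ z := by rw [hz]; apply div_nonneg <;> linarith [hwib.2, hwjb.2]
  have hz1 : z ≤ 1 := by rw [hz, div_le_one hden]; linarith [hwib.1, hwjb.1]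
  have hz' : z * (8 - 2 * l) = 4 + l / 2 - wi - wj := by rw [hz, div_mul_cancel₀ _ hden.ne']
  set i := Fin.castAdd K k with hi
  set j := Fin.natAdd K k with hj
  have hij : i ≠ j := by
    intro h
    have := congrArg Fin.val h
    simp [hi, hj] at this
    omega
  let w : Fin (K + K) → ℝ := (fun _ => l * z) + Pi.single i (wi - l * z) + Pi.single j (wj - l * z)
  have hw_i : w i = wi := by simp [w, hij]
  have hw_j : w j = wj := by simp [w, hij]
  have hw_o : ∀ x, x ≠ i → x ≠ j → w x = l * z := by
    intro x h1 h2; simp [w, h1, h2]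
  have hw_s : ∑ x, w x = l * (((K + K + 1 : ℕ) : ℝ) / 2) := by
    simp only [w, Pi.add_apply, Finset.sum_add_distrib, Finset.sum_const, Finset.card_univ,
      Fintype.card_fin, nsmul_eq_mul, Finset.sum_pi_single', Finset.mem_univ, if_true]
    push_cast
    linear_combination hz' + (2 * z - 1) * hlK
  have hsub : (fun x => x + w) '' ((1 - l) • (ev K ∩ bx k u v)) ⊆ ev K ∩ bx k u' v' := by
    rintro _ ⟨_, ⟨a, ⟨⟨ha1, ha2⟩, hb1, hb2⟩, rfl⟩, rfl⟩
    have hbi : a i ∈ Icc u (u + 1/16) := hb1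
    have hbj : a j ∈ Icc v (v + 1/16) := hb2
    have hval : ∀ x, ((1 - l) • a + w) x = (1 - l) * a x + w x := fun x => rfl
    have hi' : ((1 - l) • a + w) i ∈ Icc u' (u' + 1/16) := by
      rw [hval, hw_i, hwi]
      constructor <;> nlinarith [hbi.1, hbi.2]
    have hj' : ((1 - l) • a + w) j ∈ Icc v' (v' + 1/16) := by
      rw [hval, hw_j, hwj]
      constructor <;> nlinarith [hbj.1, hbj.2]
    refine ⟨⟨fun x => ?_, ?_⟩, hi', hj'⟩
    · by_cases h1 : x = i
      · rw [h1]; exact ⟨hu'.1.trans hi'.1, hi'.2.trans (by linarith [hu'.2])⟩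
      by_cases h2 : x = j
      · rw [h2]; exact ⟨hv'.1.trans hj'.1, hj'.2.trans (by linarith [hv'.2])⟩
      change (1 - l) * a x + w x ∈ _
      rw [hw_o x h1 h2]
      have := ha1 x
      constructor <;> nlinarith [this.1, this.2]
    · have : ∑ x, ((1 - l) • a + w) x = (1 - l) * ∑ x, a x + l * (((K + K + 1 : ℕ) : ℝ) / 2) := by
        simp only [hval, Finset.sum_add_distrib, hw_s, Finset.mul_sum]
      change _ - ∑ x, ((1 - l) • a + w) x ∈ _
      rw [this]
      have e : ((K + K + 1 : ℕ) : ℝ) / 2 - ((1 - l) * ∑ x, a x + l * (((K + K + 1 : ℕ) : ℝ) / 2))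
        = (1 - l) * (((K + K + 1 : ℕ) : ℝ) / 2 - ∑ x, a x) := by ring
      rw [e]
      constructor <;> nlinarith [ha2.1, ha2.2]
  have hvol : volume ((fun x => x + w) '' ((1 - l) • (ev K ∩ bx k u v)))
      = ENNReal.ofReal ((1 - l) ^ (K + K)) * volume (ev K ∩ bx k u v) := by
    rw [image_add_right, measure_preimage_add_right,
      Measure.addHaar_smul_of_nonneg _ (by linarith)]
    simp
  calc _ ≤ ENNReal.ofReal ((1 - l) ^ (K + K)) * volume (ev K ∩ bx k u v) := by
        gcongr
        have h1 : Real.exp (-(2 * l)) ≤ 1 - l := by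
          rw [Real.exp_neg]
          have h2 : 1 + 2 * l ≤ Real.exp (2 * l) := by linarith [Real.add_one_le_exp (2 * l)]
          calc (Real.exp (2 * l))⁻¹ ≤ (1 + 2 * l)⁻¹ := by gcongr
            _ ≤ 1 - l := by
              rw [inv_le_iff_one_le_mul₀ (by linarith)]
              nlinarith
        calc Real.exp (-16) = Real.exp (-(2 * l)) ^ (K + K) := by
              rw [← Real.exp_nat_mul]
              congr 1
              push_cast
              linear_combination 4 * hlK
          _ ≤ _ := by gcongr
    _ = _ := hvol.symm
    _ ≤ _ := measure_mono hsub

lemma box_lower {K : ℕ} (hK : 8 ≤ K) (k : Fin K) {u' v' : ℝ}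
    (hu' : u' ∈ Icc (0:ℝ) (15/16)) (hv' : v' ∈ Icc (0:ℝ) (15/16)) :
    Real.exp (-16) / 256 ≤ (nuM K).real (bx k u' v') := by
  have hcov : ev K ⊆ ⋃ p : Fin 16 × Fin 16, ev K ∩ bx k ((p.1 : ℕ) / 16 : ℝ) ((p.2 : ℕ) / 16 : ℝ) := by
    intro a ha
    have key : ∀ x ∈ Icc (0:ℝ) 1, ∃ p : Fin 16, x ∈ Icc ((p : ℕ) / 16 : ℝ) ((p : ℕ) / 16 + 1/16 : ℝ) := by
      intro x hx
      by_cases h1 : x = 1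
      · exact ⟨15, by rw [h1]; constructor <;> norm_num⟩
      have hx1 : x < 1 := lt_of_le_of_ne hx.2 h1
      have hf := Nat.floor_le (show 0 ≤ x * 16 by linarith [hx.1])
      have hf2 := Nat.lt_floor_add_one (x * 16)
      refine ⟨⟨⌊x * 16⌋₊, (Nat.floor_lt (by linarith [hx.1])).2 (by push_cast; linarith)⟩, ?_⟩
      constructor <;> simp only <;> linarith
    obtain ⟨p, hp⟩ := key _ (ha.1 (Fin.castAdd K k))
    obtain ⟨q, hq⟩ := key _ (ha.1 (Fin.natAdd K k))
    exact mem_iUnion.2 ⟨(p, q), ha, hp, hq⟩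
  have hE0 := ev_ne_zero K (by omega)
  have hEt := ev_ne_top K
  have hb : ∀ p : Fin 16, ((p : ℕ) / 16 : ℝ) ∈ Icc (0:ℝ) (15/16) := by
    intro p
    have : ((p : ℕ) : ℝ) ≤ 15 := by exact_mod_cast (by omega : (p : ℕ) ≤ 15)
    constructor
    · positivity
    · linarith
  have h1 : ENNReal.ofReal (Real.exp (-16)) * volume (ev K) ≤ 256 * volume (ev K ∩ bx k u' v') := by
    calc _ ≤ ENNReal.ofReal (Real.exp (-16)) *
          ∑ p : Fin 16 × Fin 16, volume (ev K ∩ bx k ((p.1 : ℕ) / 16 : ℝ) ((p.2 : ℕ) / 16 : ℝ)) := by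
          gcongr
          exact (measure_mono hcov).trans (measure_iUnion_fintype_le _ _)
      _ ≤ ∑ p : Fin 16 × Fin 16, volume (ev K ∩ bx k u' v') := by
          rw [Finset.mul_sum]
          exact Finset.sum_le_sum fun p _ => box_compare hK k (hb p.1) (hb p.2) hu' hv'
      _ = 256 * volume (ev K ∩ bx k u' v') := by
          simp
  have h2 : (nuM K).real (bx k u' v') = (volume (ev K)).toReal⁻¹ * (volume (ev K ∩ bx k u' v')).toReal := by
    rw [Measure.real, nuM, cond_apply (measurableSet_ev K), ENNReal.toReal_mul, ENNReal.toReal_inv]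
  have h3 := ENNReal.toReal_mono (by
    refine ENNReal.mul_ne_top (by simp) (ne_top_of_le_ne_top hEt (measure_mono inter_subset_left))) h1
  rw [ENNReal.toReal_mul, ENNReal.toReal_mul, ENNReal.toReal_ofReal (Real.exp_pos _).le] at h3
  have h4 : 0 < (volume (ev K)).toReal := ENNReal.toReal_pos hE0 hEt
  rw [h2, inv_mul_eq_div, div_le_div_iff₀ (by norm_num) h4]
  simpa [mul_comm] using h3

/-- The explicit kernel. -/
noncomputable def kap (a b : ℝ) : ℝ :=
  (1 - max a b - (1 - a ^ 2) / 2 - (1 - b ^ 2) / 2 + 1/3) - (1/2 - a) * (1/2 - b)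
    - 12 * ((1/6 - a ^ 2 / 2) - (1/2 - a) * (1/2)) * ((1/6 - b ^ 2 / 2) - (1/2 - b) * (1/2))

/-- The step function. -/
noncomputable def stp (a x : ℝ) : ℝ := if a ≤ x then 1 else 0

lemma stp_int (a : ℝ) (k : ℕ) : IntegrableOn (fun x => stp a x * x ^ k) (Icc 0 1) := by
  have : (fun x => stp a x * x ^ k) = (Ici a).indicator (fun x => x ^ k) := by
    funext x; by_cases h : a ≤ x <;> simp [stp, h]
  rw [this]
  exact ((continuous_pow k).continuousOn.integrableOn_compact isCompact_Icc).indicator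
    measurableSet_Ici

lemma stp_val (a : ℝ) (ha : a ∈ Icc (0:ℝ) 1) (k : ℕ) :
    ∫ x in Icc (0:ℝ) 1, stp a x * x ^ k = (1 - a ^ (k + 1)) / (k + 1) := by
  have : (fun x => stp a x * x ^ k) = (Ici a).indicator (fun x => x ^ k) := by
    funext x; by_cases h : a ≤ x <;> simp [stp, h]
  rw [this, setIntegral_indicator measurableSet_Ici]
  have : Icc (0:ℝ) 1 ∩ Ici a = Icc a 1 := by
    ext x; simp only [mem_inter_iff, mem_Icc, mem_Ici]
    constructor
    · rintro ⟨⟨_, h2⟩, h3⟩; exact ⟨h3, h2⟩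
    · rintro ⟨h1, h2⟩; exact ⟨⟨ha.1.trans h1, h2⟩, h1⟩
  rw [this, integral_Icc_eq_integral_Ioc, ← intervalIntegral.integral_of_le ha.2, integral_pow]
  simp

lemma pow_int (k : ℕ) : IntegrableOn (fun x : ℝ => x ^ k) (Icc 0 1) :=
  (continuous_pow k).continuousOn.integrableOn_compact isCompact_Icc

lemma pow_val (k : ℕ) : ∫ x in Icc (0:ℝ) 1, x ^ k = 1 / (k + 1) := by
  rw [integral_Icc_eq_integral_Ioc, ← intervalIntegral.integral_of_le zero_le_one, integral_pow]
  simp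

/-- Centered step function. -/
noncomputable def phi (a x : ℝ) : ℝ := stp a x - x

lemma phi1_int (a : ℝ) : IntegrableOn (phi a) (Icc 0 1) := by
  have h := (stp_int a 0).sub (pow_int 1)
  refine h.congr_fun (fun x _ => ?_) measurableSet_Icc
  simp [phi]

lemma phi1_val (a : ℝ) (ha : a ∈ Icc (0:ℝ) 1) : ∫ x in Icc (0:ℝ) 1, phi a x = 1/2 - a := by
  have e : ∀ x, phi a x = stp a x * x ^ 0 - x ^ 1 := fun x => by simp [phi]
  simp only [e]
  rw [integral_sub (stp_int a 0) (pow_int 1), stp_val a ha, pow_val]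
  norm_num; ring

lemma phix_int (a : ℝ) : IntegrableOn (fun x => phi a x * x) (Icc 0 1) := by
  have h := (stp_int a 1).sub (pow_int 2)
  refine h.congr_fun (fun x _ => ?_) measurableSet_Icc
  simp [phi]; ring

lemma phix_val (a : ℝ) (ha : a ∈ Icc (0:ℝ) 1) :
    ∫ x in Icc (0:ℝ) 1, phi a x * x = 1/6 - a ^ 2 / 2 := by
  have e : ∀ x, phi a x * x = stp a x * x ^ 1 - x ^ 2 := fun x => by simp [phi]; ring
  simp only [e]
  rw [integral_sub (stp_int a 1) (pow_int 2), stp_val a ha, pow_val]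
  norm_num; ring

lemma phiphi_eq (a b x : ℝ) : phi a x * phi b x =
    ((stp (max a b) x * x ^ 0 - stp a x * x ^ 1) - stp b x * x ^ 1) + x ^ 2 := by
  by_cases h1 : a ≤ x <;> by_cases h2 : b ≤ x <;> simp [phi, stp, h1, h2] <;> ring

lemma phiphi_int (a b : ℝ) : IntegrableOn (fun x => phi a x * phi b x) (Icc 0 1) := by
  simp only [phiphi_eq]
  exact (((stp_int _ 0).sub (stp_int _ 1)).sub (stp_int _ 1)).add (pow_int 2)

lemma phiphi_val (a b : ℝ) (ha : a ∈ Icc (0:ℝ) 1) (hb : b ∈ Icc (0:ℝ) 1) :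
    ∫ x in Icc (0:ℝ) 1, phi a x * phi b x =
      1 - max a b - (1 - a ^ 2) / 2 - (1 - b ^ 2) / 2 + 1/3 := by
  simp only [phiphi_eq]
  have i1 : IntegrableOn (fun x => stp (max a b) x * x ^ 0 - stp a x * x ^ 1) (Icc 0 1) :=
    (stp_int _ 0).sub (stp_int _ 1)
  have i2 : IntegrableOn (fun x => stp (max a b) x * x ^ 0 - stp a x * x ^ 1 - stp b x * x ^ 1)
    (Icc 0 1) := i1.sub (stp_int _ 1)
  rw [integral_add i2 (pow_int 2), integral_sub i1 (stp_int _ 1),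
    integral_sub (stp_int _ 0) (stp_int _ 1), stp_val a ha, stp_val b hb,
    stp_val _ ⟨le_max_of_le_left ha.1, max_le ha.2 hb.2⟩, pow_val]
  norm_num

lemma gDie_eq (n : ℕ) (A : Fin n → ℝ) (x : ℝ) : gDie n A x = ∑ i, phi (A i) x := by
  simp [gDie, phi, stp, Finset.sum_sub_distrib]

lemma stat_eq {n : ℕ} {A B : Fin n → ℝ} (hA : ∀ i, A i ∈ Icc (0:ℝ) 1)
    (hB : ∀ i, B i ∈ Icc (0:ℝ) 1) :
    cvDie₂ n A B - 12 * cvDie n A * cvDie n B = ∑ i, ∑ j, kap (A i) (B j) := by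
  have m1 : ∀ {A : Fin n → ℝ}, (∀ i, A i ∈ Icc (0:ℝ) 1) →
      mean01 (gDie n A) = ∑ i, (1/2 - A i) := by
    intro A hA
    simp only [mean01, gDie_eq]
    rw [integral_finsetSum _ fun i _ => phi1_int (A i)]
    exact Finset.sum_congr rfl fun i _ => phi1_val _ (hA i)
  have mx : mean01 (fun x => x) = 1/2 := by
    have := pow_val 1
    simp only [pow_one] at this
    rw [mean01, this]; norm_num
  have c1 : ∀ {A : Fin n → ℝ}, (∀ i, A i ∈ Icc (0:ℝ) 1) →
      cvDie n A = ∑ i, ((1/6 - A i ^ 2 / 2) - (1/2 - A i) * (1/2)) := by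
    intro A hA
    rw [cvDie, m1 hA, mx, Finset.sum_mul, Finset.sum_sub_distrib]
    congr 1
    simp only [mean01, gDie_eq, Finset.sum_mul]
    rw [integral_finsetSum _ fun i _ => phix_int (A i)]
    exact Finset.sum_congr rfl fun i _ => phix_val _ (hA i)
  have c2 : mean01 (fun x => gDie n A x * gDie n B x) = ∑ i, ∑ j,
      (1 - max (A i) (B j) - (1 - A i ^ 2) / 2 - (1 - B j ^ 2) / 2 + 1/3) := by
    simp only [mean01, gDie_eq, Finset.sum_mul_sum]
    rw [integral_finsetSum _ fun i _ => integrable_finsetSum _ fun j _ => phiphi_int (A i) (B j)]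
    refine Finset.sum_congr rfl fun i _ => ?_
    rw [integral_finsetSum _ fun j _ => phiphi_int (A i) (B j)]
    exact Finset.sum_congr rfl fun j _ => phiphi_val _ _ (hA i) (hB j)
  rw [cvDie₂, c2, m1 hA, m1 hB, c1 hA, c1 hB, Finset.sum_mul_sum, mul_assoc, Finset.sum_mul_sum,
    Finset.mul_sum, ← Finset.sum_sub_distrib, ← Finset.sum_sub_distrib]
  refine Finset.sum_congr rfl fun i _ => ?_
  rw [Finset.mul_sum, ← Finset.sum_sub_distrib, ← Finset.sum_sub_distrib]
  refine Finset.sum_congr rfl fun j _ => ?_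
  rw [kap]; ring

lemma kap_bound {a b : ℝ} (ha : a ∈ Icc (0:ℝ) 1) (hb : b ∈ Icc (0:ℝ) 1) : |kap a b| ≤ 10 := by
  have hq : ∀ {x : ℝ}, x ∈ Icc (0:ℝ) 1 → |(1/6 - x ^ 2 / 2) - (1/2 - x) * (1/2)| ≤ 1/4 := by
    intro x hx
    rw [abs_le]
    constructor <;> nlinarith [hx.1, hx.2, mul_nonneg hx.1 (sub_nonneg.2 hx.2), sq_nonneg (x - 1/2)]
  have hl : ∀ {x : ℝ}, x ∈ Icc (0:ℝ) 1 → |1/2 - x| ≤ 1/2 := by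
    intro x hx
    rw [abs_le]
    constructor <;> linarith [hx.1, hx.2]
  have h1 : |(1/2 - a) * (1/2 - b)| ≤ 1/2 * (1/2) := by
    rw [abs_mul]; exact mul_le_mul (hl ha) (hl hb) (abs_nonneg _) (by norm_num)
  have h2 : |((1/6 - a ^ 2 / 2) - (1/2 - a) * (1/2)) * ((1/6 - b ^ 2 / 2) - (1/2 - b) * (1/2))|
      ≤ 1/4 * (1/4) := by
    rw [abs_mul]; exact mul_le_mul (hq ha) (hq hb) (abs_nonneg _) (by norm_num)
  have h3 : max a b ∈ Icc (0:ℝ) 1 := ⟨le_max_of_le_left ha.1, max_le ha.2 hb.2⟩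
  have h4 : a ^ 2 ∈ Icc (0:ℝ) 1 := ⟨sq_nonneg a, pow_le_one₀ ha.1 ha.2⟩
  have h5 : b ^ 2 ∈ Icc (0:ℝ) 1 := ⟨sq_nonneg b, pow_le_one₀ hb.1 hb.2⟩
  rw [abs_le] at *
  rw [kap, mul_assoc]
  constructor <;> linarith [h1.1, h1.2, h2.1, h2.2, h3.1, h3.2, h4.1, h4.2, h5.1, h5.2]

/-- Difference of a pair statistic under the flip. -/
noncomputable def dif (f : ℝ → ℝ) (z : ℝ × ℝ) : ℝ :=
  f z.1 + f z.2 - f (pairFlip z).1 - f (pairFlip z).2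

/-- Double difference of the kernel. -/
noncomputable def gam (z z' : ℝ × ℝ) : ℝ := dif (fun a => dif (fun b => kap a b) z') z

lemma dif_flip (f : ℝ → ℝ) (z : ℝ × ℝ) : dif f (pairFlip z) = - dif f z := by
  simp only [dif, pairFlip_flip]; ring

lemma gam_flip_left (z z' : ℝ × ℝ) : gam (pairFlip z) z' = - gam z z' := dif_flip _ _

lemma gam_flip_right (z z' : ℝ × ℝ) : gam z (pairFlip z') = - gam z z' := by
  simp only [gam, dif_flip]; simp only [dif]; ring

lemma dif_bound {f : ℝ → ℝ} {C : ℝ} (hC : 0 ≤ C) (hf : ∀ x ∈ Icc (0:ℝ) 1, |f x| ≤ C)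
    (z : ℝ × ℝ) : |dif f z| ≤ 4 * C := by
  by_cases h : z ∈ flipR
  · have hz : z.1 ∈ Icc (0:ℝ) 1 ∧ z.2 ∈ Icc (0:ℝ) 1 := by
      simp only [flipR, mem_prod, mem_Icc] at *
      obtain ⟨⟨h1, h2⟩, h3, h4⟩ := h
      refine ⟨⟨?_, ?_⟩, ?_, ?_⟩ <;> linarith
    have hz' := pairFlip_mem z hz
    have h1 := abs_le.1 (hf _ hz.1)
    have h2 := abs_le.1 (hf _ hz.2)
    have h3 := abs_le.1 (hf _ hz'.1)
    have h4 := abs_le.1 (hf _ hz'.2)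
    rw [abs_le, dif]
    constructor <;> linarith [h1.1, h1.2, h2.1, h2.2, h3.1, h3.2, h4.1, h4.2]
  · rw [dif, pairFlip_of_notMem h]
    have : f z.1 + f z.2 - f z.1 - f z.2 = 0 := by ring
    rw [this, abs_zero]; positivity

lemma gam_bound (z z' : ℝ × ℝ) : |gam z z'| ≤ 160 := by
  have := dif_bound (C := 4 * 10) (by norm_num)
    (fun x hx => dif_bound (f := fun b => kap x b) (C := 10) (by norm_num)
      (fun y hy => kap_bound hx hy) z') z
  rw [gam]; linarith

lemma gam_lower {z z' : ℝ × ℝ} (h1 : z.1 ∈ Icc (11/16:ℝ) (11/16 + 1/16))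
    (h2 : z.2 ∈ Icc (0:ℝ) (0 + 1/16)) (h1' : z'.1 ∈ Icc (11/16:ℝ) (11/16 + 1/16))
    (h2' : z'.2 ∈ Icc (0:ℝ) (0 + 1/16)) : 1/16 ≤ gam z z' := by
  obtain ⟨a, q⟩ := z
  obtain ⟨a', q'⟩ := z'
  simp only [mem_Icc] at h1 h2 h1' h2'
  obtain ⟨h1, h3⟩ := h1
  obtain ⟨h2, h4⟩ := h2
  obtain ⟨h1', h3'⟩ := h1'
  obtain ⟨h2', h4'⟩ := h2'
  have hm : (a, q) ∈ flipR := by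
    simp only [flipR, mem_prod, mem_Icc]
    refine ⟨⟨?_, ?_⟩, ?_, ?_⟩ <;> linarith
  have hm' : (a', q') ∈ flipR := by
    simp only [flipR, mem_prod, mem_Icc]
    refine ⟨⟨?_, ?_⟩, ?_, ?_⟩ <;> linarith
  have key : gam (a, q) (a', q') = 2 * (min a a' - 1/2 - max q q')
      - 3 * (a - 1/2 - q) * (a' - 1/2 - q') := by
    simp only [gam, dif, pairFlip_of_mem hm, pairFlip_of_mem hm', kap]
    rw [max_eq_left (show q' ≤ a by linarith), max_eq_left (show q' + 1/2 ≤ a by linarith),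
      max_eq_left (show a' - 1/2 ≤ a by linarith),
      max_eq_right (show q ≤ a' by linarith), max_eq_right (show q ≤ q' + 1/2 by linarith),
      max_eq_right (show q ≤ a' - 1/2 by linarith),
      max_eq_right (show q + 1/2 ≤ a' by linarith), max_eq_left (show q' ≤ q + 1/2 by linarith),
      max_eq_left (show a' - 1/2 ≤ q + 1/2 by linarith),
      max_eq_right (show a - 1/2 ≤ a' by linarith), max_eq_left (show q' ≤ a - 1/2 by linarith),
      max_eq_right (show a - 1/2 ≤ q' + 1/2 by linarith),
      max_add_add_right, max_sub_sub_right]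
    have hmm : min a a' = a + a' - max a a' := by
      have := min_add_max a a'; linarith
    rw [hmm]
    ring
  rw [key]
  have m1 : 11/16 ≤ min a a' := le_min h1 h1'
  have m2 : max q q' ≤ 1/16 := max_le (by linarith) (by linarith)
  have m3 : (a - 1/2 - q) * (a' - 1/2 - q') ≤ 1/4 * (1/4) :=
    mul_le_mul (by linarith) (by linarith) (by linarith) (by norm_num)
  linarith

@[fun_prop]
lemma measurable_pairFlip : Measurable pairFlip := pairFlip_mp.measurable

@[fun_prop]
lemma measurable_kap {α : Type*} [MeasurableSpace α] {f g : α → ℝ} (hf : Measurable f)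
    (hg : Measurable g) : Measurable (fun p => kap (f p) (g p)) := by
  unfold kap; fun_prop

@[fun_prop]
lemma measurable_gam {α : Type*} [MeasurableSpace α] {f g : α → ℝ × ℝ} (hf : Measurable f)
    (hg : Measurable g) : Measurable (fun p => gam (f p) (g p)) := by
  simp only [gam, dif]
  fun_prop

/-- Linear statistic of the full die. -/
noncomputable def lst {K : ℕ} (a : Fin (K + K) → ℝ) (f : ℝ → ℝ) : ℝ :=
  ∑ i, f (a i) + f (((K + K + 1 : ℕ) : ℝ) / 2 - ∑ i, a i)

lemma lst_sub {K : ℕ} (a : Fin (K + K) → ℝ) (f g : ℝ → ℝ) :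
    lst a f - lst a g = lst a (fun x => f x - g x) := by
  simp only [lst, Finset.sum_sub_distrib]; ring

lemma lst_dif {K : ℕ} (a : Fin (K + K) → ℝ) (f : ℝ → ℝ) :
    lst a f - lst (dflip Finset.univ a) f = ∑ k, dif f (pr a k) := by
  simp only [lst, dflip_sum]
  rw [sum_pr, sum_pr, add_sub_add_right_eq_sub, ← Finset.sum_sub_distrib]
  refine Finset.sum_congr rfl fun k _ => ?_
  rw [pr_dflip, if_pos (Finset.mem_univ _), dif]; ring

/-- Explicit version of the statistic. -/
noncomputable def tst {K : ℕ} (a b : Fin (K + K) → ℝ) : ℝ := lst a (fun x => lst b (fun y => kap x y))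

lemma tst_dif {K : ℕ} (a b : Fin (K + K) → ℝ) :
    (tst a b - tst a (dflip Finset.univ b)) -
      (tst (dflip Finset.univ a) b - tst (dflip Finset.univ a) (dflip Finset.univ b))
      = ∑ k, ∑ l, gam (pr a k) (pr b l) := by
  simp only [tst, lst_sub, lst_dif]
  refine Finset.sum_congr rfl fun k _ => ?_
  simp only [gam]
  conv_lhs => rw [dif]
  rw [← Finset.sum_add_distrib, ← Finset.sum_sub_distrib, ← Finset.sum_sub_distrib]
  rfl

lemma measurable_tst {K : ℕ} :
    Measurable (fun p : (Fin (K + K) → ℝ) × (Fin (K + K) → ℝ) => tst p.1 p.2) := by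
  simp only [tst, lst]
  fun_prop

lemma extendDie_sum {K : ℕ} (a : Fin (K + K) → ℝ) (f : ℝ → ℝ) :
    ∑ i, f (extendDie (K + K + 1) (((K + K + 1 : ℕ) : ℝ) / 2) a i) = lst a f := by
  rw [Fin.sum_univ_castSucc, lst]
  congr 1
  · refine Finset.sum_congr rfl fun i _ => ?_
    simp [extendDie]
  · simp [extendDie]

lemma extendDie_mem {K : ℕ} {a : Fin (K + K) → ℝ} (ha : a ∈ ev K) (i : Fin (K + K + 1)) :
    extendDie (K + K + 1) (((K + K + 1 : ℕ) : ℝ) / 2) a i ∈ Icc (0:ℝ) 1 := by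
  unfold extendDie
  split_ifs
  · exact ha.1 _
  · exact ha.2

lemma measurable_extendDie (n : ℕ) (s : ℝ) : Measurable (extendDie n s) := by
  refine measurable_pi_iff.2 fun i => ?_
  unfold extendDie
  split_ifs <;> fun_prop

lemma measurable_pr {K : ℕ} (k : Fin K) :
    Measurable (fun a : Fin (K + K) → ℝ => pr a k) := by
  unfold pr; fun_prop

lemma gamX_BM {K : ℕ} (k l : Fin K) :
    BM (fun p : (Fin (K + K) → ℝ) × (Fin (K + K) → ℝ) => gam (pr p.1 k) (pr p.2 l)) :=
  ⟨measurable_gam ((measurable_pr k).comp measurable_fst) ((measurable_pr l).comp measurable_snd),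
    160, fun _ => gam_bound _ _⟩

lemma measurableSet_bx {K : ℕ} (k : Fin K) (u v : ℝ) : MeasurableSet (bx k u v) :=
  (measurableSet_Icc.preimage (measurable_pr k).fst).inter
    (measurableSet_Icc.preimage (measurable_pr k).snd)

lemma gam_sq_lower {K : ℕ} (hK : 8 ≤ K) (k l : Fin K) :
    (Real.exp (-16) / 256) ^ 2 / 256 ≤
      ∫ p, gam (pr p.1 k) (pr p.2 l) ^ 2 ∂((nuM K).prod (nuM K)) := by
  have := nuM_prob K (by omega)
  set Z := bx k (11/16) 0 ×ˢ bx l (11/16) 0 with hZ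
  have hZm : MeasurableSet Z := (measurableSet_bx _ _ _).prod (measurableSet_bx _ _ _)
  have hI : BM (Z.indicator (fun _ => (1/256:ℝ))) :=
    ⟨measurable_const.indicator hZm, 1/256, fun x => by
      by_cases hx : x ∈ Z <;> simp [hx]⟩
  have h := integral_mono (μ := (nuM K).prod (nuM K)) hI.integrable ((gamX_BM k l).pow 2).integrable (by
    intro p
    by_cases hp : p ∈ Z
    · simp only [hp, indicator_of_mem]
      have := gam_lower hp.1.1 hp.1.2 hp.2.1 hp.2.2
      nlinarith
    · simp only [hp, not_false_eq_true, indicator_of_notMem]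
      positivity)
  rw [integral_indicator_const _ hZm, hZ, measureReal_prod_prod] at h
  refine le_trans ?_ h
  have m : (11/16:ℝ) ∈ Icc (0:ℝ) (15/16) := by constructor <;> norm_num
  have m' : (0:ℝ) ∈ Icc (0:ℝ) (15/16) := by constructor <;> norm_num
  have b1 := box_lower hK k m m'
  have b2 := box_lower hK l m m'
  have h0 : 0 < Real.exp (-16) / 256 := by positivity
  have := mul_le_mul b1 b2 h0.le (h0.le.trans b1)
  rw [smul_eq_mul]
  linarith

lemma X_bound {K : ℕ} (hK : 8 ≤ K) :
    ((Real.exp (-16) / 256) ^ 2 / 256) ^ 2 / (36 * 160 ^ 4) ≤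
      ((nuM K).prod (nuM K)).real {p | (Real.exp (-16) / 256) ^ 2 / 256 * (K:ℝ) ^ 2 / 2 <
        (∑ k, ∑ l, gam (pr p.1 k) (pr p.2 l)) ^ 2} := by
  have hprob := nuM_prob K (by omega)
  have hK0 : (0:ℝ) < K := by exact_mod_cast (by omega : 0 < K)
  set d := (Real.exp (-16) / 256) ^ 2 / 256 with hd
  have hd0 : 0 < d := by positivity
  let P := (nuM K).prod (nuM K)
  have hPdef : P = (nuM K).prod (nuM K) := rfl
  have hrow : ∀ k, BM (fun p : (Fin (K + K) → ℝ) × (Fin (K + K) → ℝ) =>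
      ∑ l, gam (pr p.1 k) (pr p.2 l)) := fun k => BM.sum (gamX_BM k) Finset.univ
  have hX := BM.sum hrow Finset.univ
  have hτ1 : ∀ k, MeasurePreserving (Prod.map (dflip {k}) id) P P := fun k =>
    (dflip_nu {k}).prod (MeasurePreserving.id (nuM K))
  have hτ2 : ∀ k, MeasurePreserving (Prod.map id (dflip {k})) P P := fun k =>
    (MeasurePreserving.id (nuM K)).prod (dflip_nu {k})
  have n1 : ∀ (k : Fin K) (x : (Fin (K + K) → ℝ) × (Fin (K + K) → ℝ)), (∑ l, gam (pr (Prod.map (dflip {k}) id x).1 k) (pr (Prod.map (dflip {k}) id x).2 l))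
      = - ∑ l, gam (pr x.1 k) (pr x.2 l) := by
    intro k x
    simp [pr_dflip, gam_flip_left]
  have i1 : ∀ (k j : Fin K) (x : (Fin (K + K) → ℝ) × (Fin (K + K) → ℝ)), j ≠ k →
      (∑ l, gam (pr (Prod.map (dflip {k}) id x).1 j) (pr (Prod.map (dflip {k}) id x).2 l))
      = ∑ l, gam (pr x.1 j) (pr x.2 l) := by
    intro k j x hj
    simp [pr_dflip, hj]
  have n2 : ∀ (k l : Fin K) (x : (Fin (K + K) → ℝ) × (Fin (K + K) → ℝ)), gam (pr (Prod.map id (dflip {l}) x).1 k) (pr (Prod.map id (dflip {l}) x).2 l)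
      = - gam (pr x.1 k) (pr x.2 l) := by
    intro k l x
    simp [pr_dflip, gam_flip_right]
  have i2 : ∀ (k l j : Fin K) (x : (Fin (K + K) → ℝ) × (Fin (K + K) → ℝ)), j ≠ l →
      gam (pr (Prod.map id (dflip {l}) x).1 k) (pr (Prod.map id (dflip {l}) x).2 j)
      = gam (pr x.1 k) (pr x.2 j) := by
    intro k l j x hj
    simp [pr_dflip, hj]
  -- second moment
  have h2 : d * (K:ℝ) ^ 2 ≤ ∫ p, (∑ k, ∑ l, gam (pr p.1 k) (pr p.2 l)) ^ 2 ∂P := by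
    have e1 := second_moment (P := P) hrow hτ1 n1 i1 (BM.const 1) Finset.univ (fun _ _ _ => rfl)
    simp only [mul_one] at e1
    rw [e1]
    have e2 : ∀ k, d * K ≤ ∫ p, (∑ l, gam (pr p.1 k) (pr p.2 l)) ^ 2 ∂P := by
      intro k
      have e3 := second_moment (P := P) (gamX_BM k) hτ2 (n2 k) (i2 k) (BM.const 1) Finset.univ
        (fun _ _ _ => rfl)
      simp only [mul_one] at e3
      rw [e3]
      have := Finset.card_nsmul_le_sum (Finset.univ : Finset (Fin K))
        (fun l => ∫ p, gam (pr p.1 k) (pr p.2 l) ^ 2 ∂P) d (fun l _ => gam_sq_lower hK k l)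
      simpa [mul_comm] using this
    have := Finset.card_nsmul_le_sum (Finset.univ : Finset (Fin K))
      (fun k => ∫ p, (∑ l, gam (pr p.1 k) (pr p.2 l)) ^ 2 ∂P) (d * K) (fun k _ => e2 k)
    refine le_trans (le_of_eq ?_) this
    simp; ring
  -- fourth moment
  have h4 : ∫ p, (∑ k, ∑ l, gam (pr p.1 k) (pr p.2 l)) ^ 4 ∂P ≤ 9 * 160 ^ 4 * (K:ℝ) ^ 4 := by
    have e0 : ∀ k l, ∫ p, gam (pr p.1 k) (pr p.2 l) ^ 4 ∂P ≤ 160 ^ 4 := by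
      intro k l
      have := integral_mono (μ := P) ((gamX_BM k l).pow 4).integrable
        (BM.const ((160:ℝ) ^ 4)).integrable (fun p => by
          change gam (pr p.1 k) (pr p.2 l) ^ 4 ≤ 160 ^ 4
          rw [← Even.pow_abs (by decide : Even 4)]
          gcongr
          exact gam_bound _ _)
      simpa using this
    have e1 : ∀ k, ∫ p, (∑ l, gam (pr p.1 k) (pr p.2 l)) ^ 4 ∂P ≤ 3 * 160 ^ 4 * (K:ℝ) ^ 2 := by
      intro k
      have := fourth_moment (P := P) (gamX_BM k) hτ2 (n2 k) (i2 k) (e0 k) (by positivity)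
        Finset.univ
      simpa using this
    have := fourth_moment (P := P) hrow hτ1 n1 i1 e1 (by positivity) Finset.univ
    simp only [Finset.card_univ, Fintype.card_fin] at this
    linarith
  have hpz := paley_zygmund (P := P) hX (m := d * (K:ℝ) ^ 2) (C := 9 * 160 ^ 4 * (K:ℝ) ^ 4)
    (by positivity) (by positivity) h2 h4
  refine le_trans (le_of_eq ?_) hpz
  field_simp
  ring

theorem main_bound {K : ℕ} (hK : 8 ≤ K) {t : ℝ}
    (ht : (4 * t) ^ 2 ≤ (Real.exp (-16) / 256) ^ 2 / 256 * (K:ℝ) ^ 2 / 2) (ht0 : 0 ≤ t) :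
    ((Real.exp (-16) / 256) ^ 2 / 256) ^ 2 / (36 * 160 ^ 4) / 4 ≤
      ((nuM K).prod (nuM K)).real {p | t < |tst p.1 p.2|} := by
  have hprob := nuM_prob K (by omega)
  have hX := X_bound hK
  set P := (nuM K).prod (nuM K) with hP
  let U : Set ((Fin (K + K) → ℝ) × (Fin (K + K) → ℝ)) := {p | t < |tst p.1 p.2|}
  have hU : MeasurableSet U := measurableSet_lt measurable_const measurable_tst.abs
  have hF := dflip_nu (Finset.univ : Finset (Fin K))
  have hid := MeasurePreserving.id (nuM K)
  have hm : ∀ {f : (Fin (K + K) → ℝ) × (Fin (K + K) → ℝ) → (Fin (K + K) → ℝ) × (Fin (K + K) → ℝ)},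
      MeasurePreserving f P P → P.real (f ⁻¹' U) = P.real U := fun hf => by
    rw [Measure.real, hf.measure_preimage hU.nullMeasurableSet, Measure.real]
  have hsub : {p : (Fin (K + K) → ℝ) × (Fin (K + K) → ℝ) |
        (Real.exp (-16) / 256) ^ 2 / 256 * (K:ℝ) ^ 2 / 2 <
        (∑ k, ∑ l, gam (pr p.1 k) (pr p.2 l)) ^ 2} ⊆
      (U ∪ Prod.map id (dflip Finset.univ) ⁻¹' U) ∪
        (Prod.map (dflip Finset.univ) id ⁻¹' U ∪
          Prod.map (dflip Finset.univ) (dflip Finset.univ) ⁻¹' U) := by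
    intro p hp
    by_contra hn
    simp only [U, mem_union, mem_preimage, mem_ofPred_eq, Prod.map_fst, Prod.map_snd, id, not_or,
      not_lt] at hn
    obtain ⟨⟨q1, q2⟩, q3, q4⟩ := hn
    have hp' := lt_of_le_of_lt ht hp
    rw [← tst_dif, sq_lt_sq, abs_of_nonneg (by linarith)] at hp'
    rw [abs_le] at q1 q2 q3 q4
    rcases lt_abs.1 hp' with h | h <;> linarith [q1.1, q1.2, q2.1, q2.2, q3.1, q3.2, q4.1, q4.2]
  have h1 := measureReal_mono (μ := P) hsub
  have h2 := measureReal_union_le (μ := P) (U ∪ Prod.map id (dflip Finset.univ) ⁻¹' U)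
        (Prod.map (dflip Finset.univ) id ⁻¹' U ∪
          Prod.map (dflip Finset.univ) (dflip Finset.univ) ⁻¹' U)
  have h3 := measureReal_union_le (μ := P) U (Prod.map id (dflip Finset.univ) ⁻¹' U)
  have h4 := measureReal_union_le (μ := P) (Prod.map (dflip Finset.univ) id ⁻¹' U)
          (Prod.map (dflip Finset.univ) (dflip Finset.univ) ⁻¹' U)
  rw [hm (hid.prod hF)] at h3
  rw [hm (hF.prod hid), hm (hF.prod hF)] at h4
  change _ ≤ P.real U
  linarith

theorem cond_covariance_lower_bound :
    ∃ ε > (0 : ℝ), ∃ N : ℕ, ∀ n : ℕ, N ≤ n → Odd n →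
      ((diceMeasure n 0 1 ((n : ℝ) / 2)).prod (diceMeasure n 0 1 ((n : ℝ) / 2)))
          {p : (Fin n → ℝ) × (Fin n → ℝ) |
            |cvDie₂ n p.1 p.2 - 12 * cvDie n p.1 * cvDie n p.2| > ε * n}
        > ENNReal.ofReal ε := by
  obtain ⟨d, hd⟩ : ∃ d : ℝ, d = (Real.exp (-16) / 256) ^ 2 / 256 := ⟨_, rfl⟩
  have hd0 : 0 < d := by rw [hd]; positivity
  have hd1 : d ≤ 1 := by
    have : Real.exp (-16) ≤ 1 := Real.exp_le_one_iff.2 (by norm_num)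
    have h2 : (Real.exp (-16) / 256) ^ 2 ≤ 1 := pow_le_one₀ (by positivity) (by linarith)
    rw [hd]; linarith
  obtain ⟨c, hc⟩ : ∃ c : ℝ, c = d ^ 2 / (36 * 160 ^ 4) / 4 := ⟨_, rfl⟩
  have hc0 : 0 < c := by rw [hc]; positivity
  refine ⟨min (c / 2) (d / 20), by positivity, 16, ?_⟩
  set ε := min (c / 2) (d / 20) with hε
  have hε0 : 0 < ε := by positivity
  have hε1 : ε < c := (min_le_left _ _).trans_lt (by linarith)
  have hε2 : ε ≤ d / 20 := min_le_right _ _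
  rintro n hn ⟨K, rfl⟩
  rw [two_mul] at *
  have hK : 8 ≤ K := by omega
  have hK' : (8:ℝ) ≤ K := by exact_mod_cast hK
  have hprob := nuM_prob K (by omega)
  have hmeas : diceMeasure (K + K + 1) 0 1 (((K + K + 1 : ℕ) : ℝ) / 2)
      = Measure.map (extendDie (K + K + 1) (((K + K + 1 : ℕ) : ℝ) / 2)) (nuM K) := rfl
  have hme := measurable_extendDie (K + K + 1) (((K + K + 1 : ℕ) : ℝ) / 2)
  rw [hmeas, Measure.map_prod_map _ _ hme hme]
  refine lt_of_lt_of_le ?_ (Measure.le_map_apply (hme.prodMap hme).aemeasurable _)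
  have hb := main_bound hK (t := ε * ((K + K + 1 : ℕ) : ℝ)) (by
    rw [← hd]
    have h1 : ((K + K + 1 : ℕ) : ℝ) ≤ 3 * K := by push_cast; linarith
    calc (4 * (ε * ((K + K + 1 : ℕ) : ℝ))) ^ 2 ≤ (4 * (d / 20 * (3 * K))) ^ 2 := by gcongr
      _ = 9 / 25 * (d * d) * (K:ℝ) ^ 2 := by ring
      _ ≤ 9 / 25 * (d * 1) * (K:ℝ) ^ 2 := by gcongr
      _ ≤ d * (K:ℝ) ^ 2 / 2 := by nlinarith [mul_pos hd0 (by positivity : 0 < (K:ℝ) ^ 2)])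
    (by positivity)
  rw [← hd, ← hc] at hb
  have hlt : ENNReal.ofReal ε < ((nuM K).prod (nuM K))
      {p | ε * ((K + K + 1 : ℕ) : ℝ) < |tst p.1 p.2|} := by
    rw [← ofReal_measureReal]
    exact (ENNReal.ofReal_lt_ofReal_iff (hc0.trans_le hb)).2 (hε1.trans_le hb)
  refine hlt.trans_le (measure_mono_ae ?_)
  have a1 : ∀ᵐ p ∂((nuM K).prod (nuM K)), p.1 ∈ ev K :=
    Measure.quasiMeasurePreserving_fst.ae (nu_ae K)
  have a2 : ∀ᵐ p ∂((nuM K).prod (nuM K)), p.2 ∈ ev K :=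
    Measure.quasiMeasurePreserving_snd.ae (nu_ae K)
  filter_upwards [a1, a2] with p h1 h2 hp
  change |cvDie₂ (K + K + 1) (extendDie (K + K + 1) (((K + K + 1 : ℕ) : ℝ) / 2) p.1) (extendDie (K + K + 1) (((K + K + 1 : ℕ) : ℝ) / 2) p.2) - 12 * cvDie (K + K + 1) (extendDie (K + K + 1) (((K + K + 1 : ℕ) : ℝ) / 2) p.1) * cvDie (K + K + 1) (extendDie (K + K + 1) (((K + K + 1 : ℕ) : ℝ) / 2) p.2)| > ε * ((K + K + 1 : ℕ) : ℝ)
  rw [stat_eq (extendDie_mem h1) (extendDie_mem h2)]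
  rw [extendDie_sum p.1 (fun x => ∑ j, kap x (extendDie (K + K + 1) (((K + K + 1 : ℕ) : ℝ) / 2) p.2 j))]
  simp only [extendDie_sum]
  exact hp
end

section
/- Let n ≥ 2 and let V_1,…,V_n be i.i.d. uniform on [0,n], S := Σ_{i=1}^n V_i, and let u be the density of S − n²/2. Then: (1) u(0) ≥ 1/(4n√n), and likewise the density at 0 of a centered Gaussian with variance n³/12 is at least 1/(4n√n); (2) for every 0 < ε ≤ n√n, Pr[|S − n²/2| ≤ ε] ≥ ε/(4n√n); (3) for all reals ε_1 < ε_2, Pr[ε_1 ≤ S ≤ ε_2] ≤ (ε_2 − ε_1)/n. -/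
open MeasureTheory ProbabilityTheory Set
open scoped ENNReal NNReal

/-- The uniform probability measure on `[0,n]`. -/
noncomputable def unifN (n : ℕ) : Measure ℝ :=
  (ENNReal.ofReal (n : ℝ))⁻¹ • volume.restrict (Set.Icc (0 : ℝ) (n : ℝ))

theorem even_intervalIntegrable (G : ℝ → ℝ) (hG : ∀ x y, |x| ≤ |y| → G y ≤ G x) (a b : ℝ) :
    IntervalIntegrable G volume a b := by
  have key : ∀ b, IntervalIntegrable G volume 0 b := by
    intro b
    rcases le_total 0 b with hb | hb
    · apply AntitoneOn.intervalIntegrable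
      intro x hx y hy hxy
      rw [Set.uIcc_of_le hb] at hx hy
      apply hG
      rw [abs_of_nonneg hx.1, abs_of_nonneg hy.1]; exact hxy
    · apply MonotoneOn.intervalIntegrable
      intro x hx y hy hxy
      rw [Set.uIcc_of_ge hb] at hx hy
      apply hG
      rw [abs_of_nonpos hx.2, abs_of_nonpos hy.2]; linarith
  exact (key a).symm.trans (key b)

theorem unimodal_step (G : ℝ → ℝ) (hG : ∀ x y, |x| ≤ |y| → G y ≤ G x) (c : ℝ) (hc : 0 ≤ c)
    (x y : ℝ) (hxy : |x| ≤ |y|) :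
    ∫ s in (y - c)..(y + c), G s ≤ ∫ s in (x - c)..(x + c), G s := by
  have hi := even_intervalIntegrable G hG
  have heven : ∀ z, G (-z) = G z := fun z =>
    le_antisymm (hG _ _ (by simp)) (hG _ _ (by simp))
  have habs : ∀ z, ∫ s in (z - c)..(z + c), G s = ∫ s in (|z| - c)..(|z| + c), G s := by
    intro z
    rcases le_total 0 z with h | h
    · rw [abs_of_nonneg h]
    · rw [abs_of_nonpos h]
      have := intervalIntegral.integral_comp_neg (a := z - c) (b := z + c) (f := G)
      simp only [heven] at this
      rw [this]; congr 1 <;> ring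
  rw [habs x, habs y]
  have hx0 := abs_nonneg x
  generalize |x| = x at *
  generalize |y| = y at *
  have e := intervalIntegral.integral_interval_sub_interval_comm
    (hi (x - c) (x + c)) (hi (y - c) (y + c)) (hi (x - c) (y - c))
  have e1 := intervalIntegral.integral_comp_sub_right (a := x) (b := y) G c
  have e2 := intervalIntegral.integral_comp_add_right (a := x) (b := y) G c
  have i1 : IntervalIntegrable (fun s => G (s - c)) volume x y := by
    have := (hi (x - c) (y - c)).comp_sub_right c
    simpa using this
  have i2 : IntervalIntegrable (fun s => G (s + c)) volume x y := by
    have := (hi (x + c) (y + c)).comp_add_right c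
    simpa using this
  have : ∫ s in x..y, G (s + c) ≤ ∫ s in x..y, G (s - c) := by
    apply intervalIntegral.integral_mono_on hxy i2 i1
    intro s hs
    apply hG
    have : 0 ≤ s := hx0.trans hs.1
    rw [abs_of_nonneg (by linarith : 0 ≤ s + c), abs_le]
    constructor <;> linarith
  linarith

instance unifN_prob (n : ℕ) [NeZero n] : IsProbabilityMeasure (unifN n) := by
  constructor
  have : (0 : ℝ) < n := by exact_mod_cast Nat.pos_of_ne_zero (NeZero.ne n)
  simp only [unifN, Measure.smul_apply, Measure.restrict_apply_univ, Real.volume_Icc, sub_zero,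
    smul_eq_mul]
  exact ENNReal.inv_mul_cancel (by simpa using NeZero.ne n) (by simp)

theorem integral_unifN (n : ℕ) (f : ℝ → ℝ) :
    ∫ x, f x ∂(unifN n) = (n : ℝ)⁻¹ * ∫ x in (0 : ℝ)..n, f x := by
  rw [unifN, integral_smul_measure, intervalIntegral.integral_of_le (by positivity),
    integral_Icc_eq_integral_Ioc]
  simp

/-- Probability that the sum of `k` uniforms is within `h` of `t`. -/
noncomputable def pSum (n k : ℕ) (t h : ℝ) : ℝ :=
  (Measure.pi fun _ : Fin k => unifN n).real {x : Fin k → ℝ | |(∑ i, x i) - t| ≤ h}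

theorem meas_split (n k : ℕ) [NeZero n] (t h : ℝ) :
    (Measure.pi fun _ : Fin (k + 1) => unifN n) {x : Fin (k + 1) → ℝ | |(∑ i, x i) - t| ≤ h} =
    ((unifN n).prod (Measure.pi fun _ : Fin k => unifN n))
      {p : ℝ × (Fin k → ℝ) | |p.1 + (∑ i, p.2 i) - t| ≤ h} := by
  have hm : MeasurableSet {p : ℝ × (Fin k → ℝ) | |p.1 + (∑ i, p.2 i) - t| ≤ h} :=
    measurableSet_le (by fun_prop) (by fun_prop)
  have := (measurePreserving_piFinSuccAbove (fun _ : Fin (k + 1) => unifN n) 0).measure_preimage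
    hm.nullMeasurableSet
  rw [← this]
  congr 1
  ext x
  simp [Fin.sum_univ_succ, MeasurableEquiv.piFinSuccAbove, Fin.insertNthEquiv, Fin.tail]

theorem pSum_succ (n k : ℕ) [NeZero n] (t h : ℝ) :
    pSum n (k + 1) t h = (n : ℝ)⁻¹ * ∫ s in (t - n)..t, pSum n k s h := by
  have hm : MeasurableSet {p : ℝ × (Fin k → ℝ) | |p.1 + (∑ i, p.2 i) - t| ≤ h} :=
    measurableSet_le (by fun_prop) (by fun_prop)
  have h1 : pSum n (k + 1) t h = ∫ a, pSum n k (t - a) h ∂(unifN n) := by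
    rw [pSum, measureReal_def, meas_split, Measure.prod_apply hm, ← integral_toReal]
    · congr 1
      ext a
      rw [pSum, measureReal_def]
      congr 2
      ext x
      simp only [Set.mem_preimage, Set.mem_ofPred_eq]
      rw [show a + ∑ i, x i - t = ∑ i, x i - (t - a) by ring]
    · exact (measurable_measure_prodMk_left hm).aemeasurable
    · exact Filter.Eventually.of_forall fun a => measure_lt_top _ _
  rw [h1, integral_unifN,
    intervalIntegral.integral_comp_sub_left (fun s => pSum n k s h) t]
  simp

theorem pSum_unimodal (n : ℕ) [NeZero n] (h : ℝ) (k : ℕ) : ∀ x y : ℝ, |x| ≤ |y| →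
    pSum n k (y + k * (n / 2)) h ≤ pSum n k (x + k * (n / 2)) h := by
  induction k with
  | zero =>
    intro x y hxy
    apply measureReal_mono _ (measure_ne_top _ _)
    intro z
    simp
    intro hz
    exact hxy.trans hz
  | succ k ih =>
    have key : ∀ z : ℝ, pSum n (k + 1) (z + (k + 1 : ℕ) * (n / 2)) h = (n : ℝ)⁻¹ *
        ∫ s in (z - n / 2)..(z + n / 2), pSum n k (s + k * (n / 2)) h := by
      intro z
      rw [pSum_succ, intervalIntegral.integral_comp_add_right (fun s => pSum n k s h)]
      congr 2 <;> push_cast <;> ring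
    intro x y hxy
    rw [key, key]
    apply mul_le_mul_of_nonneg_left _ (by positivity)
    exact unimodal_step (fun s => pSum n k (s + k * (n / 2)) h) ih _ (by positivity) x y hxy

theorem pSum_center (n : ℕ) [NeZero n] (t h : ℝ) :
    pSum n n t h ≤ pSum n n ((n : ℝ) ^ 2 / 2) h := by
  have := pSum_unimodal n h n 0 (t - n * (n / 2)) (by simp)
  convert this using 2 <;> ring

theorem pSum_cover (n : ℕ) [NeZero n] (a : ℝ) (ha : 0 < a) (N : ℕ) (hN : 0 < N) :
    pSum n n ((n : ℝ) ^ 2 / 2) a ≤ N * pSum n n ((n : ℝ) ^ 2 / 2) (a / N) := by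
  have hN' : (0 : ℝ) < N := by exact_mod_cast hN
  set m := (n : ℝ) ^ 2 / 2
  have hsub : {x : Fin n → ℝ | |(∑ i, x i) - m| ≤ a} ⊆
      ⋃ k ∈ Finset.range N,
        {x : Fin n → ℝ | |(∑ i, x i) - (m - a + (2 * (k : ℝ) + 1) * (a / N))| ≤ a / N} := by
    intro x hx
    simp only [Set.mem_ofPred_eq, abs_le] at hx
    simp only [Set.mem_iUnion, Set.mem_ofPred_eq, Finset.mem_range]
    set d := a / N with hd
    have hdp : 0 < d := by positivity
    have hNd : N * d = a := by rw [hd]; field_simp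
    set w := ∑ i, x i - m + a with hw
    have hw0 : 0 ≤ w := by linarith
    rcases eq_or_lt_of_le (show w ≤ 2 * a by linarith) with h2 | h2
    · refine ⟨N - 1, by omega, ?_⟩
      rw [Nat.cast_sub hN, abs_le]
      push_cast
      constructor <;> nlinarith
    · refine ⟨⌊w / (2 * d)⌋₊, ?_, ?_⟩
      · rw [Nat.floor_lt (by positivity), div_lt_iff₀ (by positivity)]
        linarith
      · have l1 := Nat.floor_le (show 0 ≤ w / (2 * d) by positivity)
        have l2 := Nat.lt_floor_add_one (w / (2 * d))
        rw [le_div_iff₀ (by positivity)] at l1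
        rw [div_lt_iff₀ (by positivity)] at l2
        rw [abs_le]
        constructor <;> linarith
  calc pSum n n m a ≤ _ := measureReal_mono hsub (measure_ne_top _ _)
    _ ≤ _ := measureReal_biUnion_finset_le _ _
    _ ≤ ∑ k ∈ Finset.range N, pSum n n m (a / N) :=
        Finset.sum_le_sum fun k _ => pSum_center n _ _
    _ = _ := by simp

theorem unifN_ae (n : ℕ) : ∀ᵐ x ∂(unifN n), x ∈ Set.Icc (0 : ℝ) n := by
  apply Measure.ae_smul_measure
  exact ae_restrict_mem measurableSet_Icc

theorem unifN_mean (n : ℕ) [NeZero n] : ∫ x, x ∂(unifN n) = n / 2 := by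
  have : (n : ℝ) ≠ 0 := by exact_mod_cast NeZero.ne n
  rw [integral_unifN, integral_id]
  field_simp
  ring

theorem pSum_cheb (n : ℕ) [NeZero n] :
    3 / 4 ≤ pSum n n ((n : ℝ) ^ 2 / 2) (n * Real.sqrt n) := by
  have hn : (0 : ℝ) < n := by exact_mod_cast Nat.pos_of_ne_zero (NeZero.ne n)
  set P := Measure.pi fun _ : Fin n => unifN n with hP
  have hmp : ∀ i, MeasurePreserving (fun x : Fin n → ℝ => x i) P (unifN n) :=
    fun i => measurePreserving_eval (fun _ : Fin n => unifN n) i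
  have hae : ∀ i, ∀ᵐ x ∂P, x i ∈ Set.Icc (0 : ℝ) n := fun i =>
    (hmp i).quasiMeasurePreserving.ae (unifN_ae n)
  have hL : ∀ i, MemLp (fun x : Fin n → ℝ => x i) 2 P := fun i =>
    memLp_of_bounded (hae i) (measurable_pi_apply i).aestronglyMeasurable 2
  have hmean : ∀ i, ∫ x, x i ∂P = n / 2 := by
    intro i
    rw [← unifN_mean n, ← (hmp i).map_eq]
    rw [integral_map (measurable_pi_apply i).aemeasurable (by fun_prop)]
  have hE : P[∑ i, fun x : Fin n → ℝ => x i] = (n : ℝ) ^ 2 / 2 := by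
    simp only [Finset.sum_apply]
    rw [integral_finsetSum _ fun i _ => (hL i).integrable (by norm_num)]
    simp [hmean]
    ring
  have hV : variance (∑ i, fun x : Fin n → ℝ => x i) P ≤ n ^ 3 / 4 := by
    have hind : iIndepFun (fun i (x : Fin n → ℝ) => x i) P :=
      iIndepFun_pi (μ := fun _ : Fin n => unifN n) (X := fun _ x => x)
        (fun i => aemeasurable_id)
    rw [IndepFun.variance_sum (fun i _ => hL i) (fun i _ j _ hij => hind.indepFun hij)]
    calc _ ≤ ∑ i : Fin n, (((n : ℝ) - 0) / 2) ^ 2 :=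
          Finset.sum_le_sum fun i _ =>
            variance_le_sq_of_bounded (hae i) (measurable_pi_apply i).aemeasurable
      _ = _ := by simp; ring
  have hS : MemLp (∑ i, fun x : Fin n → ℝ => x i) 2 P := memLp_finsetSum' _ fun i _ => hL i
  have hc : 0 < (n : ℝ) * Real.sqrt n := by positivity
  have hch := meas_ge_le_variance_div_sq hS hc
  have hsq : ((n : ℝ) * Real.sqrt n) ^ 2 = n ^ 3 := by
    rw [mul_pow, Real.sq_sqrt hn.le]; ring
  rw [hE, hsq] at hch
  have hch2 : P.real {x : Fin n → ℝ | (n : ℝ) * Real.sqrt n ≤ |(∑ i, x i) - (n : ℝ) ^ 2 / 2|}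
      ≤ 1 / 4 := by
    rw [measureReal_def]
    apply ENNReal.toReal_le_of_le_ofReal (by norm_num)
    simp only [Finset.sum_apply] at hch
    apply hch.trans
    apply ENNReal.ofReal_le_ofReal
    rw [div_le_iff₀ (by positivity)]
    linarith
  have huniv : P.real Set.univ ≤ P.real
      ({x : Fin n → ℝ | |(∑ i, x i) - (n : ℝ) ^ 2 / 2| ≤ n * Real.sqrt n} ∪
      {x : Fin n → ℝ | (n : ℝ) * Real.sqrt n ≤ |(∑ i, x i) - (n : ℝ) ^ 2 / 2|}) := by
    apply measureReal_mono _ (measure_ne_top _ _)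
    intro x _
    simp only [Set.mem_union, Set.mem_ofPred_eq]
    exact le_total _ _
  have := measureReal_union_le (μ := P)
    {x : Fin n → ℝ | |(∑ i, x i) - (n : ℝ) ^ 2 / 2| ≤ n * Real.sqrt n}
    {x : Fin n → ℝ | (n : ℝ) * Real.sqrt n ≤ |(∑ i, x i) - (n : ℝ) ^ 2 / 2|}
  rw [probReal_univ] at huniv
  rw [pSum]
  linarith

theorem pSum_lower (n : ℕ) [NeZero n] (N : ℕ) (hN : 0 < N) :
    3 / 4 ≤ N * pSum n n ((n : ℝ) ^ 2 / 2) (n * Real.sqrt n / N) := by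
  have hn : (0 : ℝ) < n := by exact_mod_cast Nat.pos_of_ne_zero (NeZero.ne n)
  exact (pSum_cheb n).trans (pSum_cover n _ (by positivity) N hN)

theorem meas_upper (n k : ℕ) [NeZero n] (t h : ℝ) :
    (Measure.pi fun _ : Fin (k + 1) => unifN n) {x : Fin (k + 1) → ℝ | |(∑ i, x i) - t| ≤ h} ≤
      ENNReal.ofReal (2 * h / n) := by
  have hn : (0 : ℝ) < n := by exact_mod_cast Nat.pos_of_ne_zero (NeZero.ne n)
  have hm : MeasurableSet {p : ℝ × (Fin k → ℝ) | |p.1 + (∑ i, p.2 i) - t| ≤ h} :=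
    measurableSet_le (by fun_prop) (by fun_prop)
  rw [meas_split, Measure.prod_apply_symm hm]
  calc _ ≤ ∫⁻ y, ENNReal.ofReal (2 * h / n) ∂(Measure.pi fun _ : Fin k => unifN n) := by
        apply lintegral_mono
        intro y
        have hs : (fun a : ℝ => (a, y)) ⁻¹' {p : ℝ × (Fin k → ℝ) | |p.1 + (∑ i, p.2 i) - t| ≤ h}
            ⊆ Set.Icc (t - ∑ i, y i - h) (t - ∑ i, y i + h) := by
          intro a ha
          simp only [Set.mem_preimage, Set.mem_ofPred_eq, abs_le] at ha
          constructor <;> linarith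
        refine (measure_mono hs).trans ?_
        rw [unifN, Measure.smul_apply, smul_eq_mul]
        calc _ ≤ (ENNReal.ofReal (n : ℝ))⁻¹ * ENNReal.ofReal (2 * h) := by
              gcongr
              refine (Measure.restrict_apply_le _ _).trans ?_
              rw [Real.volume_Icc]
              apply ENNReal.ofReal_le_ofReal
              linarith
          _ = _ := by
              rw [ENNReal.ofReal_div_of_pos hn, div_eq_mul_inv, mul_comm]
    _ = _ := by simp

theorem sum_uniform_density_bounds (n : ℕ) (hn : 2 ≤ n) (u : ℝ → ℝ) (hu : Continuous u)
    (hdens :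
      Measure.map (fun x : Fin n → ℝ => (∑ i, x i) - (n : ℝ) ^ 2 / 2)
          (Measure.pi fun _ : Fin n => unifN n) =
        volume.withDensity fun t => ENNReal.ofReal (u t)) :
    (1 / (4 * n * Real.sqrt n) ≤ u 0 ∧
      1 / (4 * n * Real.sqrt n) ≤ gaussianPDFReal 0 ((n : ℝ≥0) ^ 3 / 12) 0) ∧
    (∀ ε : ℝ, 0 < ε → ε ≤ n * Real.sqrt n →
      ENNReal.ofReal (ε / (4 * n * Real.sqrt n)) ≤
        (Measure.pi fun _ : Fin n => unifN n)
          {x : Fin n → ℝ | |(∑ i, x i) - (n : ℝ) ^ 2 / 2| ≤ ε}) ∧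
    (∀ ε₁ ε₂ : ℝ, ε₁ < ε₂ →
      (Measure.pi fun _ : Fin n => unifN n)
          {x : Fin n → ℝ | ε₁ ≤ ∑ i, x i ∧ ∑ i, x i ≤ ε₂} ≤
        ENNReal.ofReal ((ε₂ - ε₁) / n)) := by
  haveI : NeZero n := ⟨by omega⟩
  have hn0 : (0 : ℝ) < n := by exact_mod_cast (by omega : 0 < n)
  have hs0 : 0 < Real.sqrt n := by positivity
  have hlow := pSum_lower n
  have ha : 0 < (n : ℝ) * Real.sqrt n := by positivity
  refine ⟨⟨?_, ?_⟩, ?_, ?_⟩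
  · by_contra! hlt
    rw [mul_assoc] at hlt
    set a := (n : ℝ) * Real.sqrt n
    have hev : ∀ᶠ t in nhds (0 : ℝ), u t < 1 / (4 * a) :=
      hu.continuousAt.eventually_lt continuousAt_const hlt
    obtain ⟨δ, hδ, hball⟩ := Metric.eventually_nhds_iff.1 hev
    obtain ⟨N, hN⟩ := exists_nat_gt (a / δ)
    have hN0 : (0 : ℝ) < N := lt_trans (by positivity) hN
    have hNn : 0 < N := by exact_mod_cast hN0
    have hlowN := hlow N hNn
    set d := a / N with hd
    have hdp : 0 < d := by positivity
    have hNd : N * d = a := by rw [hd]; field_simp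
    have hdδ : d < δ := by
      rw [hd, div_lt_iff₀ hN0]
      rw [div_lt_iff₀ hδ] at hN
      linarith
    have hp : pSum n n ((n : ℝ) ^ 2 / 2) d ≤ 2 * d * (1 / (4 * a)) := by
      have hm : MeasurableSet {t : ℝ | |t| ≤ d} := measurableSet_le (by fun_prop) (by fun_prop)
      have e : (Measure.pi fun _ : Fin n => unifN n)
          {x : Fin n → ℝ | |(∑ i, x i) - (n : ℝ) ^ 2 / 2| ≤ d} =
          ∫⁻ t in {t : ℝ | |t| ≤ d}, ENNReal.ofReal (u t) := by
        rw [← withDensity_apply _ hm, ← hdens, Measure.map_apply (by fun_prop) hm]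
        rfl
      rw [pSum, measureReal_def]
      apply ENNReal.toReal_le_of_le_ofReal (by positivity)
      rw [e]
      calc _ ≤ ∫⁻ t in {t : ℝ | |t| ≤ d}, ENNReal.ofReal (1 / (4 * a)) := by
            apply setLIntegral_mono measurable_const
            intro t ht
            apply ENNReal.ofReal_le_ofReal
            apply (hball _).le
            rw [Real.dist_eq, sub_zero]
            exact lt_of_le_of_lt ht hdδ
        _ = _ := by
            have hI : {t : ℝ | |t| ≤ d} = Set.Icc (-d) d := by
              ext t; simp [abs_le]
            rw [setLIntegral_const, hI, Real.volume_Icc, mul_comm,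
              ← ENNReal.ofReal_mul (by linarith)]
            congr 1; ring
    have : (N : ℝ) * pSum n n ((n : ℝ) ^ 2 / 2) d ≤ 1 / 2 := by
      calc _ ≤ (N : ℝ) * (2 * d * (1 / (4 * a))) := by gcongr
        _ = 2 * (N * d) * (1 / (4 * a)) := by ring
        _ = 1 / 2 := by rw [hNd]; field_simp; norm_num
    linarith
  · rw [gaussianPDFReal]
    simp only [sub_zero, ne_eq, OfNat.ofNat_ne_zero, not_false_eq_true, zero_pow, neg_zero,
      zero_div, Real.exp_zero, mul_one]
    rw [one_div]
    apply inv_anti₀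
    · positivity
    · apply Real.sqrt_le_iff.2 ⟨by positivity, ?_⟩
      rw [mul_pow, Real.sq_sqrt hn0.le]
      push_cast
      have := Real.pi_le_four
      have h3 : (0 : ℝ) < n ^ 3 := by positivity
      nlinarith
  · intro ε hε hεa
    rw [mul_assoc]
    set a := (n : ℝ) * Real.sqrt n
    set N := ⌈a / ε⌉₊ with hN
    have hr : 1 ≤ a / ε := by rwa [le_div_iff₀ hε, one_mul]
    have l1 : a / ε ≤ N := Nat.le_ceil _
    have l2 : (N : ℝ) < a / ε + 1 := Nat.ceil_lt_add_one (by positivity)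
    have hN0 : (0 : ℝ) < N := by linarith
    have hlowN := hlow N (by exact_mod_cast hN0)
    have hle : pSum n n ((n : ℝ) ^ 2 / 2) (a / N) ≤ pSum n n ((n : ℝ) ^ 2 / 2) ε := by
      apply measureReal_mono _ (measure_ne_top _ _)
      intro x hx
      simp only [Set.mem_ofPred_eq] at hx ⊢
      refine le_trans hx ?_
      rw [div_le_iff₀ hN0]
      rw [div_le_iff₀ hε] at l1
      linarith
    have hfin : ε / (4 * a) ≤ pSum n n ((n : ℝ) ^ 2 / 2) ε := by
      have h1 : 3 / 4 ≤ (N : ℝ) * pSum n n ((n : ℝ) ^ 2 / 2) ε :=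
        hlowN.trans (by gcongr)
      have h0 : 0 ≤ pSum n n ((n : ℝ) ^ 2 / 2) ε := measureReal_nonneg
      have h2 : 3 / 4 ≤ (2 * (a / ε)) * pSum n n ((n : ℝ) ^ 2 / 2) ε :=
        h1.trans (by gcongr; linarith)
      have h3 : ε * (3 / 4) ≤ 2 * a * pSum n n ((n : ℝ) ^ 2 / 2) ε := by
        calc _ ≤ ε * ((2 * (a / ε)) * pSum n n ((n : ℝ) ^ 2 / 2) ε) := by gcongr
          _ = _ := by field_simp
      rw [div_le_iff₀ (by positivity)]
      nlinarith
    apply (ENNReal.ofReal_le_iff_le_toReal (measure_ne_top _ _)).2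
    exact hfin
  · intro ε₁ ε₂ h12
    obtain ⟨k, hk⟩ : ∃ k, n = k + 1 := ⟨n - 1, by omega⟩
    have gen : ∀ m : ℕ, m = k + 1 → (Measure.pi fun _ : Fin m => unifN n)
          {x : Fin m → ℝ | ε₁ ≤ ∑ i, x i ∧ ∑ i, x i ≤ ε₂} ≤
        ENNReal.ofReal ((ε₂ - ε₁) / n) := by
      rintro m rfl
      have := meas_upper n k ((ε₁ + ε₂) / 2) ((ε₂ - ε₁) / 2)
      rw [mul_div_cancel₀ _ (by norm_num : (2 : ℝ) ≠ 0)] at this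
      refine (measure_mono ?_).trans this
      rintro x ⟨h1, h2⟩
      simp only [Set.mem_ofPred_eq, abs_le]
      constructor <;> linarith
    exact gen n hk
end
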